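/- arXiv:0804.2910 — 2 statements merged into one kernel-verified Lean document; each statement's English description precedes it below -/
import Mathlib

section
/- Let P ⊂ ℝ^d be a clean lattice d-polytope whose interior contains at least one lattice point, let 𝒯 be a lattice triangulation of P, and let w be a lattice point in the interior of P with w ∉ 𝒱(𝒯). Then there exists a lattice triangulation 𝒯' of P such that 𝒱(𝒯') = 𝒱(𝒯) ∪ {w}, every member of 𝒯' is contained in some member of 𝒯, and |𝒯'| ≥ |𝒯| + d. -/
open MeasureTheory Set
open scoped ENNReal

noncomputable section

/-- A point of `ℝ^d` is a lattice point if all its coordinates are integers. -/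
def IsLatticePt (d : ℕ) (x : Fin d → ℝ) : Prop := ∀ i, ∃ z : ℤ, x i = (z : ℝ)

/-- A lattice `d`-simplex: the convex hull of `d+1` affinely independent points of `ℤ^d`. -/
def IsLatticeSimplex (d : ℕ) (T : Set (Fin d → ℝ)) : Prop :=
  ∃ v : Fin (d + 1) → Fin d → ℤ,
    AffineIndependent ℝ (fun i => fun j => ((v i j : ℤ) : ℝ)) ∧
    T = convexHull ℝ (Set.range (fun i => fun j => ((v i j : ℤ) : ℝ)))

/-- A lattice `d`-polytope: convex hull of a finite set of lattice points affinely
spanning `ℝ^d`. -/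
def IsLatticePolytope (d : ℕ) (P : Set (Fin d → ℝ)) : Prop :=
  ∃ F : Finset (Fin d → ℤ),
    affineSpan ℝ ((fun v : Fin d → ℤ => fun j : Fin d => (v j : ℝ)) '' ↑F) = ⊤ ∧
    P = convexHull ℝ ((fun v : Fin d → ℤ => fun j : Fin d => (v j : ℝ)) '' ↑F)

/-- Clean: the only lattice points on the boundary are the vertices (extreme points). -/
def IsClean (d : ℕ) (P : Set (Fin d → ℝ)) : Prop :=
  frontier P ∩ {x | IsLatticePt d x} = Set.extremePoints ℝ P

/-- Unimodular equivalence of subsets of `ℝ^d`. -/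
def UnimodEquiv (d : ℕ) (P Q : Set (Fin d → ℝ)) : Prop :=
  ∃ (M : Matrix (Fin d) (Fin d) ℤ) (u : Fin d → ℤ),
    (M.det = 1 ∨ M.det = -1) ∧
    (fun x => (M.map (fun z : ℤ => (z : ℝ))).mulVec x + (fun i => (u i : ℝ))) '' P = Q

/-- `S_d(k) = conv(e_1, …, e_d, -k(e_1 + ⋯ + e_d))`. -/
def Sdk (d k : ℕ) : Set (Fin d → ℝ) :=
  convexHull ℝ
    ((Set.range fun i : Fin d => (Pi.single i 1 : Fin d → ℝ)) ∪ {fun _ => -(k : ℝ)})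

/-- `T_{a_1,…,a_d}`: vertex set `{0, e_1, …, e_{d-1}, (a_1,…,a_d)}`. -/
def Ta (d : ℕ) (a : Fin d → ℤ) : Set (Fin d → ℝ) :=
  convexHull ℝ
    ({(0 : Fin d → ℝ)} ∪
      {x | ∃ i : Fin d, i.val < d - 1 ∧ x = (Pi.single i 1 : Fin d → ℝ)} ∪
      {fun i => (a i : ℝ)})

/-- The vertex set of a triangulation: the union of the vertex sets of its members. -/
def triVertices (d : ℕ) (𝒯 : Set (Set (Fin d → ℝ))) : Set (Fin d → ℝ) :=
  ⋃ T ∈ 𝒯, Set.extremePoints ℝ T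

/-- `F` is a facet of the simplex `T`: the convex hull of all vertices of `T` but one. -/
def IsFacetOf (d : ℕ) (F T : Set (Fin d → ℝ)) : Prop :=
  ∃ u ∈ Set.extremePoints ℝ T, F = convexHull ℝ (Set.extremePoints ℝ T \ {u})

/-- A lattice triangulation of a lattice `d`-polytope `P`. -/
def IsLatticeTriangulation (d : ℕ) (P : Set (Fin d → ℝ))
    (𝒯 : Set (Set (Fin d → ℝ))) : Prop :=
  -- a finite set of lattice d-simplices contained in P
  𝒯.Finite ∧
  (∀ T ∈ 𝒯, IsLatticeSimplex d T ∧ T ⊆ P) ∧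
  -- every vertex of every member lies in P ∩ ℤ^d
  (∀ T ∈ 𝒯, ∀ x ∈ Set.extremePoints ℝ T, x ∈ P ∧ IsLatticePt d x) ∧
  -- every vertex of P is a vertex of some member
  (∀ x ∈ Set.extremePoints ℝ P, x ∈ triVertices d 𝒯) ∧
  -- interiors are pairwise disjoint
  (∀ T ∈ 𝒯, ∀ T' ∈ 𝒯, T ≠ T' → interior T ∩ interior T' = ∅) ∧
  -- each facet lies in the boundary of P or is a common facet of exactly two members
  (∀ T ∈ 𝒯, ∀ F, IsFacetOf d F T →
      F ⊆ frontier P ∨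
        ∃ T' ∈ 𝒯, T' ≠ T ∧ IsFacetOf d F T' ∧
          ∀ T'' ∈ 𝒯, IsFacetOf d F T'' → T'' = T ∨ T'' = T') ∧
  -- no member contains a point of the vertex set other than its own vertices
  (∀ T ∈ 𝒯, ∀ x ∈ triVertices d 𝒯, x ∈ T → x ∈ Set.extremePoints ℝ T) ∧
  -- the union of the members is P
  (⋃ T ∈ 𝒯, T) = P

/-- Barycentric data for a vertex set. -/
def IsB (d : ℕ) (V : Finset (Fin d → ℝ)) (l : (Fin d → ℝ) → ((Fin d → ℝ) →ᵃ[ℝ] ℝ)) : Prop :=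
  V.card = d + 1 ∧ (∀ u ∈ V, ∀ v ∈ V, l u v = if u = v then 1 else 0) ∧
  (∀ x, ∑ u ∈ V, l u x = 1) ∧ (∀ x, ∑ u ∈ V, l u x • u = x)

def IsS (d : ℕ) (V : Finset (Fin d → ℝ)) : Prop := ∃ l, IsB d V l

open Classical in
def bary (d : ℕ) (V : Finset (Fin d → ℝ)) : (Fin d → ℝ) → ((Fin d → ℝ) →ᵃ[ℝ] ℝ) :=
  if h : IsS d V then h.choose else fun _ => 0

def hull (d : ℕ) (V : Finset (Fin d → ℝ)) : Set (Fin d → ℝ) := convexHull ℝ (V : Set (Fin d → ℝ))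

section lem
variable {d : ℕ} {V : Finset (Fin d → ℝ)} {l : (Fin d → ℝ) → ((Fin d → ℝ) →ᵃ[ℝ] ℝ)}

lemma IsS.isB (h : IsS d V) : IsB d V (bary d V) := by
  unfold bary; rw [dif_pos h]; exact h.choose_spec

lemma aff_sum (f : (Fin d → ℝ) →ᵃ[ℝ] ℝ) (F : Finset (Fin d → ℝ)) (a : (Fin d → ℝ) → ℝ)
    (ha : ∑ s ∈ F, a s = 1) : f (∑ s ∈ F, a s • s) = ∑ s ∈ F, a s * f s := by
  have key : ∀ x, f x = f.linear x + f 0 := fun x => by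
    have := congrFun f.decomp x; simpa using this
  have e : ∑ s ∈ F, a s * f s = ∑ s ∈ F, a s * f.linear s + (∑ s ∈ F, a s) * f 0 := by
    rw [Finset.sum_mul, ← Finset.sum_add_distrib]
    exact Finset.sum_congr rfl fun s _ => by rw [key s, mul_add]
  rw [e, ha, one_mul, key, map_sum]
  simp only [map_smul, smul_eq_mul]

lemma aff_cont (f : (Fin d → ℝ) →ᵃ[ℝ] ℝ) : Continuous f := f.continuous_of_finiteDimensional

lemma IsB.apply (h : IsB d V l) (f : (Fin d → ℝ) →ᵃ[ℝ] ℝ) (x) :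
    f x = ∑ s ∈ V, l s x * f s := by
  conv_lhs => rw [← h.2.2.2 x]
  exact aff_sum f V _ (h.2.2.1 x)

lemma IsB.self (h : IsB d V l) {u} (hu : u ∈ V) : l u u = 1 := by simp [h.2.1 u hu u hu]
lemma IsB.ne (h : IsB d V l) {u v} (hu : u ∈ V) (hv : v ∈ V) (huv : u ≠ v) : l u v = 0 := by
  simp [h.2.1 u hu v hv, huv]

lemma IsB.mem (h : IsB d V l) (x) : x ∈ hull d V ↔ ∀ u ∈ V, 0 ≤ l u x := by
  constructor
  · intro hx u hu
    have hc : Convex ℝ {y | 0 ≤ l u y} := by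
      have := (convex_Ici (0:ℝ)).affine_preimage (l u)
      exact this
    refine convexHull_min ?_ hc hx
    intro v hv
    simp only [Set.mem_ofPred_eq, h.2.1 u hu v hv]
    split_ifs <;> norm_num
  · intro hx
    rw [← h.2.2.2 x]
    exact (convex_convexHull ℝ _).sum_mem hx (h.2.2.1 x) (fun u hu => subset_convexHull ℝ _ hu)

lemma IsB.int_of_pos (h : IsB d V l) (x) (hx : ∀ u ∈ V, 0 < l u x) : x ∈ interior (hull d V) := by
  have ho : IsOpen (⋂ u ∈ V, {y | 0 < l u y}) :=
    isOpen_biInter_finset fun u _ => isOpen_lt continuous_const (aff_cont _)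
  refine interior_maximal (fun y hy => ?_) ho (by simpa using hx)
  rw [h.mem]; intro u hu
  simp only [Set.mem_iInter, Set.mem_ofPred_eq] at hy
  exact (hy u hu).le

lemma IsB.pos_of_int (h : IsB d V l) (x) (hx : x ∈ interior (hull d V)) : ∀ u ∈ V, 0 < l u x := by
  intro u hu
  have h0 := (h.mem x).1 (interior_subset hx) u hu
  rcases h0.lt_or_eq with h1 | h1
  · exact h1
  exfalso
  have hcont : Continuous (fun t : ℝ => AffineMap.lineMap u x t : ℝ → (Fin d → ℝ)) := by
    exact AffineMap.lineMap_continuous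
  have hn : ∀ᶠ t in nhds (1:ℝ), (AffineMap.lineMap u x t : Fin d → ℝ) ∈ interior (hull d V) := by
    apply hcont.continuousAt.eventually_mem
    simpa using isOpen_interior.mem_nhds hx
  have hn2 : ∀ᶠ t in nhdsWithin (1:ℝ) (Set.Ioi 1), (AffineMap.lineMap u x t : Fin d → ℝ) ∈ interior (hull d V) :=
    hn.filter_mono nhdsWithin_le_nhds
  obtain ⟨t, ht, ht1⟩ := (hn2.and self_mem_nhdsWithin).exists
  have := (h.mem _).1 (interior_subset ht) u hu
  rw [AffineMap.apply_lineMap, h.self hu, ← h1, AffineMap.lineMap_apply] at this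
  simp at this
  have : (1:ℝ) < t := ht1
  linarith

lemma IsB.nonempty (h : IsB d V l) : V.Nonempty := by
  rw [← Finset.card_pos, h.1]; omega

def cent (d : ℕ) (F : Finset (Fin d → ℝ)) : Fin d → ℝ := ∑ s ∈ F, ((F.card : ℝ)⁻¹) • s

lemma cent_apply {F : Finset (Fin d → ℝ)} (hF : F.Nonempty) (f : (Fin d → ℝ) →ᵃ[ℝ] ℝ) :
    f (cent d F) = ∑ s ∈ F, ((F.card : ℝ)⁻¹) * f s := by
  apply aff_sum f F (fun _ => (F.card : ℝ)⁻¹)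
  have : (F.card : ℝ) ≠ 0 := by exact_mod_cast hF.card_pos.ne'
  simp [this]

lemma cent_mem {F : Finset (Fin d → ℝ)} (hF : F.Nonempty) : cent d F ∈ hull d F := by
  have : (F.card : ℝ) ≠ 0 := by exact_mod_cast hF.card_pos.ne'
  exact (convex_convexHull ℝ _).sum_mem (fun _ _ => by positivity) (by simp [this])
    (fun u hu => subset_convexHull ℝ _ hu)

lemma cent_pos {F : Finset (Fin d → ℝ)} (f : (Fin d → ℝ) →ᵃ[ℝ] ℝ)
    (h0 : ∀ s ∈ F, 0 ≤ f s) {s} (hs : s ∈ F) (h1 : 0 < f s) : 0 < f (cent d F) := by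
  have hF : F.Nonempty := ⟨s, hs⟩
  have : (0:ℝ) < (F.card : ℝ) := by exact_mod_cast hF.card_pos
  rw [cent_apply hF]
  exact Finset.sum_pos' (fun s hs => mul_nonneg (by positivity) (h0 s hs))
    ⟨s, hs, mul_pos (by positivity) h1⟩

lemma cent_zero {F : Finset (Fin d → ℝ)} (hF : F.Nonempty) (f : (Fin d → ℝ) →ᵃ[ℝ] ℝ)
    (h0 : ∀ s ∈ F, f s = 0) : f (cent d F) = 0 := by
  rw [cent_apply hF]
  exact Finset.sum_eq_zero fun s hs => by rw [h0 s hs, mul_zero]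

lemma IsB.int_ne (h : IsB d V l) : (interior (hull d V)).Nonempty := by
  refine ⟨cent d V, h.int_of_pos _ fun u hu => cent_pos _ (fun s hs => ?_) hu ?_⟩
  · rw [h.2.1 u hu s hs]; split_ifs <;> norm_num
  · rw [h.self hu]; norm_num

lemma IsB.meet (h : IsB d V l) {U : Set (Fin d → ℝ)} (hU : IsOpen U) {x} (hx : x ∈ U)
    (hxV : x ∈ hull d V) : ∃ y ∈ U, y ∈ interior (hull d V) := by
  have : x ∈ closure (interior (hull d V)) := by
    rw [show closure (interior (hull d V)) = closure (hull d V) from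
      (convex_convexHull ℝ _).closure_interior_eq_closure_of_nonempty_interior h.int_ne]
    exact subset_closure hxV
  exact mem_closure_iff.1 this U hU hx

lemma IsB.extreme (h : IsB d V l) : Set.extremePoints ℝ (hull d V) = (V : Set (Fin d → ℝ)) := by
  apply Set.Subset.antisymm (extremePoints_convexHull_subset)
  intro u hu
  rw [mem_extremePoints_iff_left]
  refine ⟨subset_convexHull ℝ _ hu, fun x hx y hy hxy => ?_⟩
  have hu' : u ∈ V := hu
  obtain ⟨a, b, ha, hb, hab, rfl⟩ := hxy
  have key : ∀ s ∈ V, s ≠ a • x + b • y → l s x = 0 := by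
    intro s hs hne
    have h1 := h.ne hs hu' hne
    rw [Convex.combo_affine_apply hab] at h1
    have h2 := (h.mem x).1 hx s hs
    have h3 := (h.mem y).1 hy s hs
    simp only [smul_eq_mul] at h1
    have := mul_nonneg hb.le h3
    have := mul_nonneg ha.le h2
    have h4 : a * l s x = 0 := by linarith
    rcases mul_eq_zero.1 h4 with h5 | h5
    · exact absurd h5 ha.ne'
    · exact h5
  have e1 := h.2.2.1 x
  have e2 := h.2.2.2 x
  rw [Finset.sum_eq_single_of_mem _ hu' (fun s hs hne => key s hs hne)] at e1
  rw [Finset.sum_eq_single_of_mem _ hu' (fun s hs hne => by rw [key s hs hne, zero_smul]), e1, one_smul] at e2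
  exact e2.symm

lemma hull_mono {A B : Finset (Fin d → ℝ)} (h : A ⊆ B) : hull d A ⊆ hull d B :=
  convexHull_mono (by exact_mod_cast h)

lemma IsB.extreme_sub (h : IsB d V l) {F} (hF : F ⊆ V) :
    Set.extremePoints ℝ (hull d F) = (F : Set (Fin d → ℝ)) := by
  apply Set.Subset.antisymm (extremePoints_convexHull_subset)
  intro x hx
  apply inter_extremePoints_subset_extremePoints_of_subset (hull_mono hF)
  refine ⟨subset_convexHull ℝ _ hx, ?_⟩
  rw [h.extreme]; exact hF hx

lemma isS_of_indep (p : Fin (d+1) → Fin d → ℝ) (hp : AffineIndependent ℝ p) :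
    IsS d (Finset.univ.image p) := by
  have htop : affineSpan ℝ (Set.range p) = ⊤ := by
    rw [hp.affineSpan_eq_top_iff_card_eq_finrank_add_one]; simp
  let b : AffineBasis (Fin (d+1)) ℝ (Fin d → ℝ) := ⟨p, hp, htop⟩
  have hb : ∀ i, b i = p i := fun i => rfl
  have hinv : ∀ i, Function.invFun p (p i) = i := Function.leftInverse_invFun hp.injective
  refine ⟨fun u => b.coord (Function.invFun p u), ?_, ?_, ?_, ?_⟩
  · rw [Finset.card_image_of_injective _ hp.injective]; simp
  · simp only [Finset.mem_image, Finset.mem_univ, true_and]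
    rintro _ ⟨i, rfl⟩ _ ⟨j, rfl⟩
    rw [hinv, ← hb j, b.coord_apply]
    simp [hb, hp.injective.eq_iff]
  · intro x
    rw [Finset.sum_image hp.injective.injOn]
    simp [hinv]
  · intro x
    rw [Finset.sum_image hp.injective.injOn]
    simp only [hinv]
    exact b.linear_combination_coord_eq_self x

lemma IsB.indep (h : IsB d V l) : AffineIndependent ℝ (fun i : V => (i : Fin d → ℝ)) := by
  rw [affineIndependent_iff_of_fintype]
  intro a ha hs i
  rw [Finset.weightedVSub_eq_linear_combination _ ha] at hs
  have hs' := congrArg (l i).linear hs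
  rw [map_sum, map_zero] at hs'
  have key : ∀ x, (l i).linear x = l i x - l i 0 := fun x => by
    have := congrFun (l i).decomp x; simp at this; linarith
  simp_rw [map_smul, key, smul_eq_mul, mul_sub, Finset.sum_sub_distrib, ← Finset.sum_mul, ha] at hs'
  rw [Finset.sum_eq_single_of_mem i (Finset.mem_univ _)] at hs'
  · rw [h.self i.2] at hs'; linarith
  · intro j _ hj
    rw [h.ne i.2 j.2 (fun e => hj (Subtype.ext e.symm)), mul_zero]

lemma lattice_iff (T : Set (Fin d → ℝ)) :
    IsLatticeSimplex d T ↔ ∃ V, IsS d V ∧ (∀ v ∈ V, IsLatticePt d v) ∧ T = hull d V := by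
  constructor
  · rintro ⟨v, hv, rfl⟩
    refine ⟨_, isS_of_indep _ hv, ?_, ?_⟩
    · simp only [Finset.mem_image, Finset.mem_univ, true_and]
      rintro _ ⟨i, rfl⟩ j
      exact ⟨v i j, rfl⟩
    · unfold hull; simp
  · rintro ⟨V, ⟨l, hl⟩, hV, rfl⟩
    let e : Fin (d+1) ≃ V := (Fintype.equivFinOfCardEq (by simpa using hl.1)).symm
    choose! z hz using hV
    refine ⟨fun i => z (e i), ?_, ?_⟩
    · have : (fun i => fun j => ((z (e i) j : ℤ) : ℝ)) = (fun i : V => (i : Fin d → ℝ)) ∘ e := by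
        funext i j; exact (hz _ (e i).2 j).symm
      rw [this]
      exact hl.indep.comp_embedding e.toEmbedding
    · have : (fun i => fun j => ((z (e i) j : ℤ) : ℝ)) = (fun i : V => (i : Fin d → ℝ)) ∘ e := by
        funext i j; exact (hz _ (e i).2 j).symm
      rw [this, e.surjective.range_comp]
      unfold hull; simp

lemma isB_sub (h : IsB d V l) {u w} (hu : u ∈ V) (hw : 0 < l u w) (hwV : w ∉ V) :
    IsB d (insert w (V.erase u)) (fun s => if s = w then (l u w)⁻¹ • l u
      else l s - (l s w / l u w) • l u) := by
  have hwe : w ∉ V.erase u := fun hh => hwV (Finset.mem_of_mem_erase hh)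
  have hne : ∀ s ∈ V.erase u, s ≠ w := fun s hs e => hwe (e ▸ hs)
  have hw0 := hw.ne'
  refine ⟨?_, ?_, ?_, ?_⟩
  · rw [Finset.card_insert_of_notMem hwe, Finset.card_erase_of_mem hu, h.1]; rfl
  · intro s hs t ht
    rw [Finset.mem_insert] at hs ht
    rcases hs with rfl | hs <;> rcases ht with rfl | ht
    · simp [hw0]
    · have h1 := Finset.mem_erase.1 ht
      simp [(hne t ht).symm, h.ne hu h1.2 h1.1.symm]
    · simp [hne s hs, hw0]
    · have h1 := Finset.mem_erase.1 ht
      have h2 := Finset.mem_erase.1 hs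
      simp [hne s hs, h.ne hu h1.2 h1.1.symm, h.2.1 s h2.2 t h1.2]
  · intro x
    rw [Finset.sum_insert hwe, Finset.sum_congr (g := fun s => (l s - (l s w / l u w) • l u) x) rfl
      (fun s hs => by simp only [if_neg (hne s hs)])]
    have e1 := h.2.2.1 x
    have e2 := h.2.2.1 w
    rw [← Finset.add_sum_erase _ _ hu] at e1 e2
    simp only [if_true, AffineMap.coe_smul, AffineMap.coe_sub, Pi.smul_apply, Pi.sub_apply, smul_eq_mul,
      Finset.sum_sub_distrib, ← Finset.sum_mul, ← Finset.sum_div]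
    rw [eq_sub_of_add_eq' e1, eq_sub_of_add_eq' e2]
    field_simp; ring
  · intro x
    rw [Finset.sum_insert hwe, Finset.sum_congr (g := fun s => (l s - (l s w / l u w) • l u) x • s) rfl
      (fun s hs => by simp only [if_neg (hne s hs)])]
    have e1 := h.2.2.2 x
    have e2 := h.2.2.2 w
    rw [← Finset.add_sum_erase _ _ hu] at e1 e2
    have e3 : ∑ s ∈ V.erase u, (l s w / l u w * l u x) • s = (l u x / l u w) • ∑ s ∈ V.erase u, l s w • s := by
      rw [Finset.smul_sum]
      refine Finset.sum_congr rfl fun s _ => ?_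
      rw [smul_smul]; congr 1; ring
    simp only [if_true, AffineMap.coe_smul, AffineMap.coe_sub, Pi.smul_apply, Pi.sub_apply, smul_eq_mul,
      Finset.sum_sub_distrib, sub_smul]
    rw [e3, eq_sub_of_add_eq' e1, eq_sub_of_add_eq' e2, smul_sub, smul_smul, 
      div_mul_cancel₀ _ hw0, inv_mul_eq_div]
    abel

end lem

structure Tri (d : ℕ) (P : Set (Fin d → ℝ)) (C : Finset (Finset (Fin d → ℝ))) : Prop where
  simp : ∀ V ∈ C, IsS d V
  lat : ∀ V ∈ C, ∀ v ∈ V, IsLatticePt d v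
  sub : ∀ V ∈ C, hull d V ⊆ P
  ext : ∀ x ∈ Set.extremePoints ℝ P, ∃ V ∈ C, x ∈ V
  disj : ∀ V ∈ C, ∀ V' ∈ C, V ≠ V' → interior (hull d V) ∩ interior (hull d V') = ∅
  facet : ∀ V ∈ C, ∀ u ∈ V, hull d (V.erase u) ⊆ frontier P ∨
    ∃ V' ∈ C, V' ≠ V ∧ (∃ u' ∈ V', V'.erase u' = V.erase u) ∧
      ∀ V'' ∈ C, ∀ u'' ∈ V'', V''.erase u'' = V.erase u → V'' = V ∨ V'' = V'
  vert : ∀ V ∈ C, ∀ V' ∈ C, ∀ x ∈ V', x ∈ hull d V → x ∈ V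
  cover : ∀ x ∈ P, ∃ V ∈ C, x ∈ hull d V

section conv
variable {d : ℕ}

lemma facet_iff {V : Finset (Fin d → ℝ)} (h : IsS d V) (F) :
    IsFacetOf d F (hull d V) ↔ ∃ u ∈ V, F = hull d (V.erase u) := by
  unfold IsFacetOf
  rw [h.isB.extreme]
  simp [hull]

lemma hull_inj {V V' F F' : Finset (Fin d → ℝ)} (h : IsS d V) (h' : IsS d V') (hF : F ⊆ V)
    (hF' : F' ⊆ V') (e : hull d F = hull d F') : F = F' := by
  have := congrArg (Set.extremePoints ℝ) e
  rw [h.isB.extreme_sub hF, h'.isB.extreme_sub hF'] at this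
  exact_mod_cast this

lemma triVertices_eq {C : Finset (Finset (Fin d → ℝ))} (h : ∀ V ∈ C, IsS d V) (x) :
    x ∈ triVertices d (hull d '' C) ↔ ∃ V ∈ C, x ∈ V := by
  unfold triVertices
  simp only [Set.mem_iUnion, Set.mem_image, Finset.mem_coe, exists_prop]
  constructor
  · rintro ⟨_, ⟨V, hV, rfl⟩, hx⟩
    rw [(h V hV).isB.extreme] at hx
    exact ⟨V, hV, hx⟩
  · rintro ⟨V, hV, hx⟩
    refine ⟨_, ⟨V, hV, rfl⟩, ?_⟩
    rw [(h V hV).isB.extreme]; exact hx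

lemma tri_iff {P : Set (Fin d → ℝ)} {C : Finset (Finset (Fin d → ℝ))} (h : ∀ V ∈ C, IsS d V)
    (hl : ∀ V ∈ C, ∀ v ∈ V, IsLatticePt d v) :
    IsLatticeTriangulation d P (hull d '' C) ↔ Tri d P C := by
  have hinj : ∀ V ∈ C, ∀ V' ∈ C, hull d V = hull d V' → V = V' := fun V hV V' hV' e =>
    hull_inj (h V hV) (h V' hV') subset_rfl subset_rfl e
  constructor
  · rintro ⟨h1, h2, h3, h4, h5, h6, h7, h8⟩
    refine ⟨h, hl, fun V hV => (h2 _ ⟨V, hV, rfl⟩).2, fun x hx => (triVertices_eq h x).1 (h4 x hx),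
      ?_, ?_, ?_, ?_⟩
    · intro V hV V' hV' hne
      exact h5 _ ⟨V, hV, rfl⟩ _ ⟨V', hV', rfl⟩ fun e => hne (hinj V hV V' hV' e)
    · intro V hV u hu
      rcases h6 _ ⟨V, hV, rfl⟩ _ ((facet_iff (h V hV) _).2 ⟨u, hu, rfl⟩) with hf | ⟨_, ⟨V', hV', rfl⟩, hne, hf, huq⟩
      · exact Or.inl hf
      · refine Or.inr ⟨V', hV', fun e => hne (by rw [e]), ?_, ?_⟩
        · obtain ⟨u', hu', e⟩ := (facet_iff (h V' hV') _).1 hf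
          exact ⟨u', hu', (hull_inj (h V hV) (h V' hV') (Finset.erase_subset _ _) (Finset.erase_subset _ _) e).symm⟩
        · intro V'' hV'' u'' hu'' e
          rcases huq _ ⟨V'', hV'', rfl⟩ ((facet_iff (h V'' hV'') _).2 ⟨u'', hu'', by rw [e]⟩) with e | e
          · exact Or.inl (hinj _ hV'' _ hV e)
          · exact Or.inr (hinj _ hV'' _ hV' e)
    · intro V hV V' hV' x hx hxV
      have := h7 _ ⟨V, hV, rfl⟩ x ((triVertices_eq h x).2 ⟨V', hV', hx⟩) hxV
      rw [(h V hV).isB.extreme] at this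
      exact this
    · intro x hx
      rw [← h8] at hx
      simp only [Set.mem_iUnion, Set.mem_image, Finset.mem_coe, exists_prop] at hx
      obtain ⟨_, ⟨V, hV, rfl⟩, hx⟩ := hx
      exact ⟨V, hV, hx⟩
  · intro H
    refine ⟨C.finite_toSet.image _, ?_, ?_, fun x hx => (triVertices_eq h x).2 (H.ext x hx), ?_, ?_, ?_, ?_⟩
    · rintro _ ⟨V, hV, rfl⟩
      exact ⟨(lattice_iff _).2 ⟨V, h V hV, hl V hV, rfl⟩, H.sub V hV⟩
    · rintro _ ⟨V, hV, rfl⟩ x hx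
      rw [(h V hV).isB.extreme] at hx
      exact ⟨H.sub V hV (subset_convexHull ℝ _ hx), hl V hV x hx⟩
    · rintro _ ⟨V, hV, rfl⟩ _ ⟨V', hV', rfl⟩ hne
      exact H.disj V hV V' hV' fun e => hne (by rw [e])
    · rintro _ ⟨V, hV, rfl⟩ F hF
      obtain ⟨u, hu, rfl⟩ := (facet_iff (h V hV) _).1 hF
      rcases H.facet V hV u hu with hf | ⟨V', hV', hne, ⟨u', hu', e⟩, huq⟩
      · exact Or.inl hf
      · refine Or.inr ⟨_, ⟨V', hV', rfl⟩, fun e => hne (hinj _ hV' _ hV e), (facet_iff (h V' hV') _).2 ⟨u', hu', by rw [e]⟩, ?_⟩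
        rintro _ ⟨V'', hV'', rfl⟩ hf
        obtain ⟨u'', hu'', e⟩ := (facet_iff (h V'' hV'') _).1 hf
        rcases huq V'' hV'' u'' hu'' (hull_inj (h V hV) (h V'' hV'') (Finset.erase_subset _ _) (Finset.erase_subset _ _) e).symm with e | e
        · left; rw [e]
        · right; rw [e]
    · rintro _ ⟨V, hV, rfl⟩ x hx hxV
      obtain ⟨V', hV', hx'⟩ := (triVertices_eq h x).1 hx
      rw [(h V hV).isB.extreme]
      exact H.vert V hV V' hV' x hx' hxV
    · apply Set.Subset.antisymm
      · simp only [Set.iUnion_subset_iff]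
        rintro _ ⟨V, hV, rfl⟩
        exact H.sub V hV
      · intro x hx
        obtain ⟨V, hV, hx⟩ := H.cover x hx
        simp only [Set.mem_iUnion, exists_prop]
        exact ⟨_, ⟨V, hV, rfl⟩, hx⟩

lemma exists_C {P : Set (Fin d → ℝ)} {𝒯 : Set (Set (Fin d → ℝ))} (h : IsLatticeTriangulation d P 𝒯) :
    ∃ C : Finset (Finset (Fin d → ℝ)), 𝒯 = hull d '' C ∧ Tri d P C := by
  have h2 : ∀ T ∈ 𝒯, ∃ V, IsS d V ∧ (∀ v ∈ V, IsLatticePt d v) ∧ T = hull d V := fun T hT =>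
    (lattice_iff T).1 (h.2.1 T hT).1
  choose! f hf1 hf2 hf3 using h2
  have e : 𝒯 = hull d '' (h.1.toFinset.image f : Finset _) := by
    ext T
    simp only [Finset.coe_image, Set.Finite.coe_toFinset, Set.mem_image, exists_exists_and_eq_and]
    constructor
    · intro hT; exact ⟨T, hT, (hf3 T hT).symm⟩
    · rintro ⟨T', hT', rfl⟩; rw [← hf3 T' hT']; exact hT'
  refine ⟨_, e, ?_⟩
  rw [← tri_iff, ← e]
  · exact h
  · simp only [Finset.mem_image, Set.Finite.mem_toFinset]
    rintro _ ⟨T, hT, rfl⟩; exact hf1 T hT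
  · simp only [Finset.mem_image, Set.Finite.mem_toFinset]
    rintro _ ⟨T, hT, rfl⟩; exact hf2 T hT

lemma Tri.ncard {P : Set (Fin d → ℝ)} {C : Finset (Finset (Fin d → ℝ))} (H : Tri d P C) :
    (hull d '' (C : Set (Finset (Fin d → ℝ)))).ncard = C.card := by
  rw [Set.InjOn.ncard_image, Set.ncard_coe_finset]
  intro V hV V' hV' e
  exact hull_inj (H.simp V hV) (H.simp V' hV') subset_rfl subset_rfl e

end conv

section main
variable {d : ℕ} {P : Set (Fin d → ℝ)} {C : Finset (Finset (Fin d → ℝ))}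

lemma Tri.M (H : Tri d P C) {V S} (hV : V ∈ C) (hS : S ∈ C) {y} (hy : y ∈ interior (hull d S))
    (hyV : y ∈ hull d V) : S = V := by
  by_contra hne
  obtain ⟨z, hz, hz'⟩ := (H.simp V hV).isB.meet isOpen_interior hy hyV
  have := H.disj S hS V hV hne
  exact (this ▸ (⟨hz, hz'⟩ : z ∈ interior (hull d S) ∩ interior (hull d V)) : z ∈ (∅ : Set _))

/-- transfer of coordinates through a shared facet -/
lemma shared_coord {V V' : Finset (Fin d → ℝ)} (h : IsS d V) (h' : IsS d V') {v v'} (hv : v ∈ V) (hv' : v' ∈ V')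
    (e : V'.erase v' = V.erase v) (x) : bary d V v x = bary d V' v' x * bary d V v v' := by
  rw [h'.isB.apply (bary d V v) x]
  apply Finset.sum_eq_single_of_mem _ hv'
  intro s hs hne
  have : s ∈ V.erase v := e ▸ Finset.mem_erase.2 ⟨hne, hs⟩
  have := Finset.mem_erase.1 this
  rw [h.isB.ne hv this.2 this.1.symm, mul_zero]

/-- points on the shared facet have the same coordinates -/
lemma shared_coord0 {V V' : Finset (Fin d → ℝ)} (h : IsS d V) (h' : IsS d V') {v v'} (hv : v ∈ V) (hv' : v' ∈ V')
    (e : V'.erase v' = V.erase v) {x} (hx : bary d V v x = 0) :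
    bary d V' v' x = 0 ∧ ∀ s ∈ V.erase v, bary d V' s x = bary d V s x := by
  constructor
  · have h1 := shared_coord h h' hv hv' e x
    have h2 := shared_coord h' h hv' hv e.symm x
    rw [hx, zero_mul] at h2; exact h2
  · intro s hs
    have hsV' : s ∈ V'.erase v' := e ▸ hs
    have hs1 := Finset.mem_erase.1 hs
    have hs2 := Finset.mem_erase.1 hsV'
    rw [h.isB.apply (bary d V' s) x, Finset.sum_eq_single_of_mem _ hs1.2, h'.isB.self hs2.2, mul_one]
    intro t ht hne
    by_cases htv : t = v
    · rw [htv, hx, zero_mul]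
    · have : t ∈ V'.erase v' := e ▸ Finset.mem_erase.2 ⟨htv, ht⟩
      rw [h'.isB.ne hs2.2 (Finset.mem_of_mem_erase this) hne.symm, mul_zero]

lemma face_mem {V : Finset (Fin d → ℝ)} (h : IsS d V) {v} {x} (hx : bary d V v x = 0)
    (hx' : ∀ s ∈ V.erase v, 0 ≤ bary d V s x) : x ∈ hull d V := by
  rw [h.isB.mem]
  intro s hs
  by_cases hsv : s = v
  · rw [hsv, hx]
  · exact hx' s (Finset.mem_erase.2 ⟨hsv, hs⟩)

lemma Tri.side (H : Tri d P C) {V V'} (hV : V ∈ C) (hV' : V' ∈ C) (hne : V' ≠ V) {v v'} (hv : v ∈ V) (hv' : v' ∈ V')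
    (e : V'.erase v' = V.erase v) {c} (hc : bary d V v c = 0) (hc' : ∀ s ∈ V.erase v, 0 < bary d V s c) :
    bary d V v v' < 0 := by
  have h := H.simp V hV
  have h' := H.simp V' hV'
  have hcm : c ∈ hull d V' := by
    obtain ⟨h1, h2⟩ := shared_coord0 h h' hv hv' e hc
    exact face_mem h' h1 (fun s hs => by rw [e] at hs; rw [h2 s hs]; exact (hc' s hs).le)
  have hn0 : bary d V v v' ≠ 0 := by
    intro h0
    have := shared_coord h h' hv hv' e v
    rw [h0, mul_zero, h.isB.self hv] at this
    norm_num at this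
  by_contra hcon
  push Not at hcon
  have ho : IsOpen (⋂ u ∈ V.erase v, {y | 0 < bary d V u y}) :=
    isOpen_biInter_finset fun u _ => isOpen_lt continuous_const (aff_cont _)
  obtain ⟨y, hy, hyi⟩ := h'.isB.meet ho (x := c) (by simpa using hc') hcm
  simp only [Set.mem_iInter, Set.mem_ofPred_eq] at hy
  apply hne
  refine H.M hV hV' hyi ?_
  rw [h.isB.mem]
  intro s hs
  by_cases hsv : s = v
  · rw [hsv, shared_coord h h' hv hv' e]
    exact mul_nonneg ((h'.isB.mem y).1 (interior_subset hyi) _ hv') hcon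
  · exact (hy s (Finset.mem_erase.2 ⟨hsv, hs⟩)).le

lemma Tri.nbhd (H : Tri d P C) {V V'} (hV : V ∈ C) (hV' : V' ∈ C) (hne : V' ≠ V) {v v'} (hv : v ∈ V) (hv' : v' ∈ V')
    (e : V'.erase v' = V.erase v) {c} (hc : bary d V v c = 0) (hc' : ∀ s ∈ V.erase v, 0 < bary d V s c)
    {S} (hS : S ∈ C) (hcS : c ∈ hull d S) : S = V ∨ S = V' := by
  have h := H.simp V hV
  have h' := H.simp V' hV'
  have ha := H.side hV hV' hne hv hv' e hc hc'
  obtain ⟨h1, h2⟩ := shared_coord0 h h' hv hv' e hc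
  have ho : IsOpen (⋂ u ∈ V.erase v, {y | 0 < bary d V u y}) :=
    isOpen_biInter_finset fun u _ => isOpen_lt continuous_const (aff_cont _)
  have ho' : IsOpen (⋂ u ∈ V.erase v, {y | 0 < bary d V' u y}) :=
    isOpen_biInter_finset fun u _ => isOpen_lt continuous_const (aff_cont _)
  obtain ⟨y, ⟨hy1, hy2⟩, hyi⟩ := (H.simp S hS).isB.meet (ho.inter ho') (x := c)
    ⟨by simpa using hc', by
      simp only [Set.mem_iInter, Set.mem_ofPred_eq]
      intro s hs; rw [h2 s hs]; exact hc' s hs⟩ hcS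
  simp only [Set.mem_iInter, Set.mem_ofPred_eq] at hy1 hy2
  rcases le_total 0 (bary d V v y) with h0 | h0
  · left
    refine H.M hV hS hyi ?_
    rw [h.isB.mem]
    intro s hs
    by_cases hsv : s = v
    · rw [hsv]; exact h0
    · exact (hy1 s (Finset.mem_erase.2 ⟨hsv, hs⟩)).le
  · right
    refine H.M hV' hS hyi ?_
    rw [h'.isB.mem]
    intro s hs
    by_cases hsv : s = v'
    · rw [hsv]
      rw [shared_coord h h' hv hv' e] at h0
      by_contra hcon
      push Not at hcon
      have := mul_pos_of_neg_of_neg hcon ha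
      linarith
    · exact (hy2 s (e ▸ Finset.mem_erase.2 ⟨hsv, hs⟩)).le

end main

def carr (d : ℕ) (w : Fin d → ℝ) (V : Finset (Fin d → ℝ)) : Finset (Fin d → ℝ) :=
  {u ∈ V | 0 < bary d V u w}

def stel (d : ℕ) (w : Fin d → ℝ) (V : Finset (Fin d → ℝ)) (u : Fin d → ℝ) : Finset (Fin d → ℝ) :=
  insert w (V.erase u)

open Classical in
def refi (d : ℕ) (w : Fin d → ℝ) (C : Finset (Finset (Fin d → ℝ))) : Finset (Finset (Fin d → ℝ)) :=
  {V ∈ C | w ∉ hull d V} ∪ ({V ∈ C | w ∈ hull d V}).biUnion fun V => (carr d w V).image (stel d w V)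

section refine_sec
variable {d : ℕ} {P : Set (Fin d → ℝ)} {C : Finset (Finset (Fin d → ℝ))} {w : Fin d → ℝ}

lemma mem_carr {V : Finset (Fin d → ℝ)} {u} : u ∈ carr d w V ↔ u ∈ V ∧ 0 < bary d V u w := by
  simp [carr]

lemma mem_refi {X} : X ∈ refi d w C ↔ (X ∈ C ∧ w ∉ hull d X) ∨
    ∃ V ∈ C, w ∈ hull d V ∧ ∃ u ∈ carr d w V, X = stel d w V u := by
  simp only [refi, Finset.mem_union, Finset.mem_filter, Finset.mem_biUnion, Finset.mem_image, and_assoc,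
    eq_comm (a := X)]

lemma other {V : Finset (Fin d → ℝ)} (h : IsS d V) (hw : w ∈ hull d V) (hwV : w ∉ V) (x) :
    ∃ u ∈ carr d w V, u ≠ x := by
  by_contra hcon
  push Not at hcon
  have hz : ∀ u ∈ V, u ≠ x → bary d V u w = 0 := by
    intro u hu hux
    by_contra h0
    exact hux (hcon u (mem_carr.2 ⟨hu, lt_of_le_of_ne ((h.isB.mem w).1 hw u hu) (Ne.symm h0)⟩))
  have e1 := h.isB.2.2.1 w
  have e2 := h.isB.2.2.2 w
  by_cases hx : x ∈ V
  · rw [Finset.sum_eq_single_of_mem _ hx hz] at e1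
    rw [Finset.sum_eq_single_of_mem _ hx (fun u hu hne => by rw [hz u hu hne, zero_smul]), e1, one_smul] at e2
    exact hwV (e2 ▸ hx)
  · rw [Finset.sum_eq_zero (fun u hu => hz u hu (fun e => hx (e ▸ hu)))] at e1
    norm_num at e1

lemma stel_isB {V : Finset (Fin d → ℝ)} (h : IsS d V) (hwV : w ∉ V) {u} (hu : u ∈ carr d w V) :
    IsB d (stel d w V u) (fun s => if s = w then (bary d V u w)⁻¹ • bary d V u
      else bary d V s - (bary d V s w / bary d V u w) • bary d V u) :=
  isB_sub h.isB (mem_carr.1 hu).1 (mem_carr.1 hu).2 hwV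

lemma stel_sub {V : Finset (Fin d → ℝ)} (hw : w ∈ hull d V) (u) :
    hull d (stel d w V u) ⊆ hull d V := by
  apply convexHull_min _ (convex_convexHull ℝ _)
  intro x hx
  rcases Finset.mem_insert.1 (Finset.mem_coe.1 hx) with rfl | hx
  · exact hw
  · exact subset_convexHull ℝ _ (Finset.mem_of_mem_erase hx)

lemma stel_cover {V : Finset (Fin d → ℝ)} (h : IsS d V) (hw : w ∈ hull d V) (hwV : w ∉ V) {x} (hx : x ∈ hull d V) :
    ∃ u ∈ carr d w V, x ∈ hull d (stel d w V u) := by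
  have hne : (carr d w V).Nonempty := by
    obtain ⟨u, hu, _⟩ := other h hw hwV 0
    exact ⟨u, hu⟩
  obtain ⟨u, hu, hmin⟩ := Finset.exists_min_image (carr d w V) (fun u => bary d V u x / bary d V u w) hne
  refine ⟨u, hu, ?_⟩
  have hu1 := mem_carr.1 hu
  rw [(stel_isB h hwV hu).mem]
  intro s hs
  have hx' := (h.isB.mem x).1 hx
  rcases Finset.mem_insert.1 hs with rfl | hs
  · have := hx' u hu1.1
    have := hu1.2
    simp only [if_true, AffineMap.coe_smul, Pi.smul_apply, smul_eq_mul]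
    positivity
  · have hs' := Finset.mem_erase.1 hs
    rw [if_neg (fun e : s = w => hwV (e ▸ hs'.2))]
    simp only [AffineMap.coe_smul, AffineMap.coe_sub, Pi.sub_apply, Pi.smul_apply, smul_eq_mul]
    by_cases hsc : s ∈ carr d w V
    · have h1 := hmin s hsc
      have h2 := (mem_carr.1 hsc).2
      rw [le_div_iff₀ h2] at h1
      have : bary d V s w / bary d V u w * bary d V u x = bary d V u x / bary d V u w * bary d V s w := by ring
      linarith
    · have : bary d V s w = 0 := by
        by_contra h0
        exact hsc (mem_carr.2 ⟨hs'.2, lt_of_le_of_ne ((h.isB.mem w).1 hw s hs'.2) (Ne.symm h0)⟩)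
      rw [this]; simpa using hx' s hs'.2

lemma stel_disj {V : Finset (Fin d → ℝ)} (h : IsS d V) (hwV : w ∉ V) {u v}
    (hu : u ∈ carr d w V) (hv : v ∈ carr d w V) (huv : u ≠ v) :
    interior (hull d (stel d w V u)) ∩ interior (hull d (stel d w V v)) = ∅ := by
  rw [Set.eq_empty_iff_forall_notMem]
  rintro x ⟨hxu, hxv⟩
  have hu1 := mem_carr.1 hu
  have hv1 := mem_carr.1 hv
  have a := (stel_isB h hwV hu).pos_of_int x hxu v (by simp [stel, huv.symm, hv1.1])
  have b := (stel_isB h hwV hv).pos_of_int x hxv u (by simp [stel, huv, hu1.1])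
  rw [if_neg (fun e : v = w => hwV (e ▸ hv1.1))] at a
  rw [if_neg (fun e : u = w => hwV (e ▸ hu1.1))] at b
  simp only [AffineMap.coe_smul, AffineMap.coe_sub, Pi.sub_apply, Pi.smul_apply, smul_eq_mul] at a b
  have hu2 := hu1.2
  have hv2 := hv1.2
  have a' := mul_pos hu2 a
  have b' := mul_pos hv2 b
  have e1 : bary d V u w * (bary d V v x - bary d V v w / bary d V u w * bary d V u x) =
    bary d V u w * bary d V v x - bary d V v w * bary d V u x := by field_simp
  have e2 : bary d V v w * (bary d V u x - bary d V u w / bary d V v w * bary d V v x) =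
    bary d V v w * bary d V u x - bary d V u w * bary d V v x := by field_simp
  rw [e1] at a'; rw [e2] at b'
  linarith

lemma stel_same {V X : Finset (Fin d → ℝ)} (hwV : w ∉ V) {u y s u''} (hs : s ∈ V)
    (hX : X = stel d w V s) (e : X.erase u'' = (stel d w V u).erase y) : s = u ∨ s = y := by
  by_contra hcon
  push Not at hcon
  have h1 : s ∈ (stel d w V u).erase y := by simp [stel, hcon, hs]
  rw [← e] at h1
  have h2 := Finset.mem_of_mem_erase h1
  rw [hX] at h2
  simp only [stel, Finset.mem_insert, Finset.mem_erase, ne_eq, not_true, false_and, or_false] at h2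
  exact hwV (h2 ▸ hs)

/-- neighbour across a facet containing `w` -/
lemma Tri.neighbor (H : Tri d P C) (hwP : w ∈ interior P) {V} (hV : V ∈ C) (hw : w ∈ hull d V)
    {y} (hy : y ∈ V) (hyc : y ∉ carr d w V) : bary d V y w = 0 ∧ ∃ V' ∈ C, V' ≠ V ∧ ∃ v' ∈ V',
      V'.erase v' = V.erase y ∧ w ∈ hull d V' ∧ carr d w V' = carr d w V := by
  have h := H.simp V hV
  have hnn := (h.isB.mem w).1 hw
  have h0 : bary d V y w = 0 := by
    by_contra h0
    exact hyc (mem_carr.2 ⟨hy, lt_of_le_of_ne (hnn y hy) (Ne.symm h0)⟩)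
  refine ⟨h0, ?_⟩
  have hwF : w ∈ hull d (V.erase y) := by
    have e1 := h.isB.2.2.1 w
    have e2 := h.isB.2.2.2 w
    rw [← Finset.add_sum_erase _ _ hy, h0, zero_add] at e1
    rw [← Finset.add_sum_erase _ _ hy, h0, zero_smul, zero_add] at e2
    rw [← e2]
    exact (convex_convexHull ℝ _).sum_mem (fun s hs => hnn s (Finset.mem_of_mem_erase hs)) e1
      (fun u hu => subset_convexHull ℝ _ hu)
  rcases H.facet V hV y hy with hf | ⟨V', hV', hne, ⟨v', hv', e⟩, -⟩
  · exact absurd hwP (hf hwF).2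
  · obtain ⟨h1, h2⟩ := shared_coord0 h (H.simp V' hV') hy hv' e h0
    refine ⟨V', hV', hne, v', hv', e, hull_mono (e ▸ Finset.erase_subset _ _) hwF, ?_⟩
    ext s
    rw [mem_carr, mem_carr]
    constructor
    · rintro ⟨hs, hp⟩
      have hsv : s ≠ v' := fun e' => by rw [e', h1] at hp; exact lt_irrefl _ hp
      have : s ∈ V.erase y := e ▸ Finset.mem_erase.2 ⟨hsv, hs⟩
      exact ⟨Finset.mem_of_mem_erase this, by rw [← h2 s this]; exact hp⟩
    · rintro ⟨hs, hp⟩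
      have hsv : s ≠ y := fun e' => by rw [e', h0] at hp; exact lt_irrefl _ hp
      have hsy : s ∈ V.erase y := Finset.mem_erase.2 ⟨hsv, hs⟩
      have : s ∈ V'.erase v' := e ▸ hsy
      exact ⟨Finset.mem_of_mem_erase this, by rw [h2 s hsy]; exact hp⟩

lemma Tri.refi_vert (H : Tri d P C) (hwP : w ∈ interior P) (hwV : ∀ V ∈ C, w ∉ V) (x) :
    (∃ X ∈ refi d w C, x ∈ X) ↔ (∃ V ∈ C, x ∈ V) ∨ x = w := by
  constructor
  · rintro ⟨X, hX, hx⟩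
    rcases mem_refi.1 hX with ⟨h1, _⟩ | ⟨V, hV, hwh, u, hu, rfl⟩
    · exact Or.inl ⟨X, h1, hx⟩
    · rcases Finset.mem_insert.1 hx with rfl | hx
      · exact Or.inr rfl
      · exact Or.inl ⟨V, hV, Finset.mem_of_mem_erase hx⟩
  · rintro (⟨V, hV, hx⟩ | rfl)
    · by_cases hw : w ∈ hull d V
      · obtain ⟨u, hu, hne⟩ := other (H.simp V hV) hw (hwV V hV) x
        exact ⟨_, mem_refi.2 (Or.inr ⟨V, hV, hw, u, hu, rfl⟩), by simp [stel, hne.symm, hx]⟩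
      · exact ⟨V, mem_refi.2 (Or.inl ⟨hV, hw⟩), hx⟩
    · obtain ⟨V, hV, hw⟩ := H.cover x (interior_subset hwP)
      obtain ⟨u, hu, hne⟩ := other (H.simp V hV) hw (hwV V hV) x
      exact ⟨_, mem_refi.2 (Or.inr ⟨V, hV, hw, u, hu, rfl⟩), by simp [stel]⟩

lemma Tri.refi_facet (H : Tri d P C) (hwP : w ∈ interior P) (hwV : ∀ V ∈ C, w ∉ V)
    {V} (hV : V ∈ C) (hw : w ∈ hull d V) {u} (hu : u ∈ carr d w V) {y} (hy : y ∈ stel d w V u) :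
    hull d ((stel d w V u).erase y) ⊆ frontier P ∨
    ∃ V' ∈ refi d w C, V' ≠ stel d w V u ∧ (∃ u' ∈ V', V'.erase u' = (stel d w V u).erase y) ∧
      ∀ V'' ∈ refi d w C, ∀ u'' ∈ V'', V''.erase u'' = (stel d w V u).erase y →
        V'' = stel d w V u ∨ V'' = V' := by
  have h := H.simp V hV
  have hu1 := mem_carr.1 hu
  have hnn := (h.isB.mem w).1 hw
  have hwVV := hwV V hV
  have huw : u ≠ w := fun e => hwVV (e ▸ hu1.1)
  by_cases hyw : y = w
  · subst hyw
    have e0 : (stel d y V u).erase y = V.erase u := by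
      rw [stel, Finset.erase_insert]
      exact fun hh => hwVV (Finset.mem_of_mem_erase hh)
    rw [e0]
    rcases H.facet V hV u hu1.1 with hf | ⟨V', hV', hne, ⟨u', hu', e⟩, huq⟩
    · exact Or.inl hf
    right
    have hwV' : y ∉ hull d V' := by
      intro hyV'
      have hs : bary d V u u' < 0 := by
        obtain ⟨t, ht, htu⟩ := other h hw hwVV u
        have hte : t ∈ V.erase u := Finset.mem_erase.2 ⟨htu, (mem_carr.1 ht).1⟩
        refine H.side hV hV' hne hu1.1 hu' e (c := cent d (V.erase u)) ?_ ?_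
        · apply cent_zero ⟨t, hte⟩
          intro s hs
          have := Finset.mem_erase.1 hs
          exact h.isB.ne hu1.1 this.2 this.1.symm
        · intro s hs
          have hs' := Finset.mem_erase.1 hs
          refine cent_pos _ (fun r hr => ?_) hs (by rw [h.isB.self hs'.2]; norm_num)
          exact (h.isB.mem r).1 (subset_convexHull ℝ _ (Finset.mem_of_mem_erase hr)) s hs'.2
      have h1 := shared_coord h (H.simp V' hV') hu1.1 hu' e y
      have h2 := ((H.simp V' hV').isB.mem y).1 hyV' u' hu'
      have := mul_nonpos_of_nonneg_of_nonpos h2 hs.le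
      linarith [hu1.2]
    refine ⟨V', mem_refi.2 (Or.inl ⟨hV', hwV'⟩), ?_, ⟨u', hu', e⟩, ?_⟩
    · intro e'
      exact hwV V' hV' (e' ▸ hy)
    · intro X hX u'' hu'' eX
      rcases mem_refi.1 hX with ⟨h1, h2⟩ | ⟨S, hS, hwS, s, hs, rfl⟩
      · rcases huq X h1 u'' hu'' eX with rfl | rfl
        · exact absurd hw h2
        · exact Or.inr rfl
      · left
        have hu''y : u'' = y := by
          by_contra hcon
          have : y ∈ (stel d y S s).erase u'' := Finset.mem_erase.2 ⟨Ne.symm hcon, by simp [stel]⟩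
          rw [eX] at this
          exact hwVV (Finset.mem_of_mem_erase this)
        subst hu''y
        have e1 : (stel d u'' S s).erase u'' = S.erase s := by
          rw [stel, Finset.erase_insert]
          exact fun hh => hwV S hS (Finset.mem_of_mem_erase hh)
        rw [e1] at eX
        rcases huq S hS s (mem_carr.1 hs).1 eX with rfl | rfl
        · rw [stel, eX, stel]
        · exact absurd hwS hwV'
  · right
    have hyV : y ∈ V ∧ y ≠ u := by
      rcases Finset.mem_insert.1 hy with h1 | h1
      · exact absurd h1 hyw
      · exact (Finset.mem_erase.1 h1).symm
    have hwF : w ∈ (stel d w V u).erase y := Finset.mem_erase.2 ⟨Ne.symm hyw, by simp [stel]⟩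
    have hFne : ((stel d w V u).erase y).Nonempty := ⟨w, hwF⟩
    have hcm := cent_mem hFne
    set c := cent d ((stel d w V u).erase y) with hcdef
    have hFV : ∀ s ∈ (stel d w V u).erase y, s ∈ hull d V := fun s hs =>
      stel_sub hw u (subset_convexHull ℝ _ (Finset.mem_of_mem_erase hs))
    have hcpos : ∀ t ∈ V.erase y, 0 < bary d V t c := by
      intro t ht
      have ht' := Finset.mem_erase.1 ht
      by_cases htu : t = u
      · subst htu
        exact cent_pos _ (fun s hs => (h.isB.mem s).1 (hFV s hs) t ht'.2) hwF hu1.2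
      · exact cent_pos _ (fun s hs => (h.isB.mem s).1 (hFV s hs) t ht'.2)
          (s := t) (by simp [stel, ht', htu]) (by rw [h.isB.self ht'.2]; norm_num)
    have hmemC : ∀ X ∈ C, ∀ u'', X.erase u'' = (stel d w V u).erase y → False := by
      intro X hX u'' eX
      rw [← eX] at hwF
      exact hwV X hX (Finset.mem_of_mem_erase hwF)
    have hcS : ∀ S, w ∈ hull d S → ∀ s u'', (stel d w S s).erase u'' = (stel d w V u).erase y → c ∈ hull d S := by
      intro S hwS s u'' eX
      rw [← eX] at hcm
      exact stel_sub hwS s (hull_mono (Finset.erase_subset _ _) hcm)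
    by_cases hyc : y ∈ carr d w V
    · refine ⟨stel d w V y, mem_refi.2 (Or.inr ⟨V, hV, hw, y, hyc, rfl⟩), ?_, ⟨u, ?_, ?_⟩, ?_⟩
      · intro e
        have : u ∈ stel d w V y := by simp [stel, hu1.1, hyV.2.symm]
        rw [e] at this
        simp [stel, huw] at this
      · simp [stel, hu1.1, hyV.2.symm]
      · ext t
        simp only [stel, Finset.mem_erase, Finset.mem_insert]
        grind
      · intro X hX u'' hu'' eX
        rcases mem_refi.1 hX with ⟨h1, h2⟩ | ⟨S, hS, hwS, s, hs, rfl⟩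
        · exact (hmemC X h1 u'' eX).elim
        · have hci : c ∈ interior (hull d V) := by
            apply h.isB.int_of_pos
            intro t ht
            by_cases hty : t = y
            · subst hty
              exact cent_pos _ (fun s hs => (h.isB.mem s).1 (hFV s hs) t ht) hwF (mem_carr.1 hyc).2
            · exact hcpos t (Finset.mem_erase.2 ⟨hty, ht⟩)
          have hVS := H.M hS hV hci (hcS S hwS s u'' eX)
          subst hVS
          rcases stel_same hwVV (mem_carr.1 hs).1 rfl eX with rfl | rfl
          · exact Or.inl rfl
          · exact Or.inr rfl
    · obtain ⟨h0, V', hV', hne, v', hv', e, hwV', hcarr⟩ := H.neighbor hwP hV hw hyV.1 hyc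
      have huV' : u ∈ carr d w V' := hcarr ▸ hu
      have hv'w : v' ≠ w := fun e' => hwV V' hV' (e' ▸ hv')
      have hv'u : v' ≠ u := by
        intro e'
        have h1 := (shared_coord0 h (H.simp V' hV') hyV.1 hv' e h0).1
        have h2 := (mem_carr.1 huV').2
        rw [← e', h1] at h2
        exact lt_irrefl _ h2
      have hmem : ∀ t, (t ≠ v' ∧ t ∈ V') ↔ (t ≠ y ∧ t ∈ V) := by
        intro t; rw [← Finset.mem_erase, ← Finset.mem_erase, e]
      have eF : (stel d w V' u).erase v' = (stel d w V u).erase y := by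
        ext t
        have := hmem t
        simp only [stel, Finset.mem_erase, Finset.mem_insert]
        grind
      refine ⟨stel d w V' u, mem_refi.2 (Or.inr ⟨V', hV', hwV', u, huV', rfl⟩), ?_, ⟨v', ?_, eF⟩, ?_⟩
      · intro e'
        apply hne
        ext t
        have h1 : t ∈ stel d w V' u ↔ t ∈ stel d w V u := by rw [e']
        have h2 := hwV V' hV'
        have h3 := (mem_carr.1 huV').1
        have h4 := hu1.1
        simp only [stel, Finset.mem_erase, Finset.mem_insert] at h1
        grind
      · simp [stel, hv'u, hv']
      · intro X hX u'' hu'' eX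
        rcases mem_refi.1 hX with ⟨h1, h2⟩ | ⟨S, hS, hwS, s, hs, rfl⟩
        · exact (hmemC X h1 u'' eX).elim
        · have hc0 : bary d V y c = 0 := by
            apply cent_zero hFne
            intro s hs
            have hs' := Finset.mem_erase.1 hs
            rcases Finset.mem_insert.1 hs'.2 with rfl | h2
            · exact h0
            · exact h.isB.ne hyV.1 (Finset.mem_of_mem_erase h2) hs'.1.symm
          rcases H.nbhd hV hV' hne hyV.1 hv' e hc0 hcpos hS (hcS S hwS s u'' eX) with rfl | rfl
          · rcases stel_same hwVV (mem_carr.1 hs).1 rfl eX with rfl | rfl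
            · exact Or.inl rfl
            · exact absurd hs hyc
          · rw [← eF] at eX
            rcases stel_same (hwV S hS) (mem_carr.1 hs).1 rfl eX with rfl | rfl
            · exact Or.inr rfl
            · have h1 := (shared_coord0 h (H.simp S hS) hyV.1 hv' e h0).1
              have h2 := (mem_carr.1 hs).2
              rw [h1] at h2
              exact absurd h2 (lt_irrefl _)

lemma Tri.refi_parent {X} (hX : X ∈ refi d w C) : ∃ V ∈ C, hull d X ⊆ hull d V := by
  rcases mem_refi.1 hX with ⟨h1, _⟩ | ⟨V, hV, hwh, u, hu, rfl⟩
  · exact ⟨X, h1, subset_rfl⟩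
  · exact ⟨V, hV, stel_sub hwh u⟩

lemma Tri.refi_tri (H : Tri d P C) (hwP : w ∈ interior P) (hwl : IsLatticePt d w) (hwV : ∀ V ∈ C, w ∉ V) :
    Tri d P (refi d w C) := by
  refine ⟨?_, ?_, ?_, ?_, ?_, ?_, ?_, ?_⟩
  · intro X hX
    rcases mem_refi.1 hX with ⟨h1, _⟩ | ⟨V, hV, hwh, u, hu, rfl⟩
    · exact H.simp X h1
    · exact ⟨_, stel_isB (H.simp V hV) (hwV V hV) hu⟩
  · intro X hX x hx
    rcases (H.refi_vert hwP hwV x).1 ⟨X, hX, hx⟩ with ⟨V, hV, hx⟩ | rfl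
    · exact H.lat V hV x hx
    · exact hwl
  · intro X hX
    obtain ⟨V, hV, hs⟩ := Tri.refi_parent hX
    exact hs.trans (H.sub V hV)
  · intro x hx
    exact (H.refi_vert hwP hwV x).2 (Or.inl (H.ext x hx))
  · intro X hX X' hX' hne
    have key : ∀ V ∈ C, ∀ V' ∈ C, hull d X ⊆ hull d V → hull d X' ⊆ hull d V' → V ≠ V' →
        interior (hull d X) ∩ interior (hull d X') = ∅ := by
      intro V hV V' hV' h1 h2 hne'
      rw [← Set.subset_empty_iff, ← H.disj V hV V' hV' hne']
      exact Set.inter_subset_inter (interior_mono h1) (interior_mono h2)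
    rcases mem_refi.1 hX with ⟨h1, h1'⟩ | ⟨V, hV, hwh, u, hu, rfl⟩ <;>
    rcases mem_refi.1 hX' with ⟨h2, h2'⟩ | ⟨V', hV', hwh', u', hu', rfl⟩
    · exact H.disj X h1 X' h2 hne
    · exact key X h1 V' hV' subset_rfl (stel_sub hwh' u') (fun e => h1' (e ▸ hwh'))
    · exact key V hV X' h2 (stel_sub hwh u) subset_rfl (fun e => h2' (e ▸ hwh))
    · by_cases e : V = V'
      · subst e
        exact stel_disj (H.simp V hV) (hwV V hV) hu hu' (fun e => hne (by rw [e]))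
      · exact key V hV V' hV' (stel_sub hwh u) (stel_sub hwh' u') e
  · intro X hX y hy
    rcases mem_refi.1 hX with ⟨h1, h1'⟩ | ⟨V, hV, hwh, u, hu, rfl⟩
    · rcases H.facet X h1 y hy with hf | ⟨V', hV', hne, ⟨u', hu', e⟩, huq⟩
      · exact Or.inl hf
      by_cases hwV' : w ∈ hull d V'
      · -- V' is subdivided
        have hu'c : u' ∈ carr d w V' := by
          by_contra hcon
          obtain ⟨h0, -⟩ := H.neighbor hwP hV' hwV' hu' hcon
          obtain ⟨h2, h3⟩ := shared_coord0 (H.simp V' hV') (H.simp X h1) hu' hy e.symm h0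
          apply h1'
          refine face_mem (H.simp X h1) h2 fun s hs => ?_
          rw [← e] at hs
          rw [h3 s hs]
          exact ((H.simp V' hV').isB.mem w).1 hwV' s (Finset.mem_of_mem_erase hs)
        have e0 : (stel d w V' u').erase w = X.erase y := by
          rw [stel, Finset.erase_insert, e]
          exact fun hh => hwV V' hV' (Finset.mem_of_mem_erase hh)
        refine Or.inr ⟨stel d w V' u', mem_refi.2 (Or.inr ⟨V', hV', hwV', u', hu'c, rfl⟩), ?_,
          ⟨w, by simp [stel], e0⟩, ?_⟩
        · intro e'
          exact hwV X h1 (e' ▸ by simp [stel])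
        · intro X'' hX'' u'' hu'' eX
          rcases mem_refi.1 hX'' with ⟨h2, h2'⟩ | ⟨S, hS, hwS, s, hs, rfl⟩
          · rcases huq X'' h2 u'' hu'' eX with rfl | rfl
            · exact Or.inl rfl
            · exact absurd hwV' h2'
          · right
            have hu''w : u'' = w := by
              by_contra hcon
              have : w ∈ (stel d w S s).erase u'' := Finset.mem_erase.2 ⟨Ne.symm hcon, by simp [stel]⟩
              rw [eX] at this
              exact hwV X h1 (Finset.mem_of_mem_erase this)
            subst hu''w
            have e1 : (stel d u'' S s).erase u'' = S.erase s := by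
              rw [stel, Finset.erase_insert]
              exact fun hh => hwV S hS (Finset.mem_of_mem_erase hh)
            rw [e1] at eX
            rcases huq S hS s (mem_carr.1 hs).1 eX with rfl | rfl
            · exact absurd hwS h1'
            · rw [stel, eX, ← e, stel]
      · refine Or.inr ⟨V', mem_refi.2 (Or.inl ⟨hV', hwV'⟩), hne, ⟨u', hu', e⟩, ?_⟩
        intro X'' hX'' u'' hu'' eX
        rcases mem_refi.1 hX'' with ⟨h2, h2'⟩ | ⟨S, hS, hwS, s, hs, rfl⟩
        · exact huq X'' h2 u'' hu'' eX
        · exfalso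
          have hu''w : u'' = w := by
            by_contra hcon
            have : w ∈ (stel d w S s).erase u'' := Finset.mem_erase.2 ⟨Ne.symm hcon, by simp [stel]⟩
            rw [eX] at this
            exact hwV X h1 (Finset.mem_of_mem_erase this)
          subst hu''w
          have e1 : (stel d u'' S s).erase u'' = S.erase s := by
            rw [stel, Finset.erase_insert]
            exact fun hh => hwV S hS (Finset.mem_of_mem_erase hh)
          rw [e1] at eX
          rcases huq S hS s (mem_carr.1 hs).1 eX with rfl | rfl
          · exact absurd hwS h1'
          · exact absurd hwS hwV'
    · exact H.refi_facet hwP hwV hV hwh hu hy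
  · intro X hX X' hX' x hx hxX
    rcases mem_refi.1 hX with ⟨h1, h1'⟩ | ⟨V, hV, hwh, u, hu, rfl⟩
    · rcases (H.refi_vert hwP hwV x).1 ⟨X', hX', hx⟩ with ⟨V, hV, hx⟩ | rfl
      · exact H.vert X h1 V hV x hx hxX
      · exact absurd hxX h1'
    · rcases (H.refi_vert hwP hwV x).1 ⟨X', hX', hx⟩ with ⟨V', hV', hx⟩ | rfl
      · have hxV := H.vert V hV V' hV' x hx (stel_sub hwh u hxX)
        have h1 : x ∈ Set.extremePoints ℝ (hull d (stel d w V u)) := by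
          apply inter_extremePoints_subset_extremePoints_of_subset (stel_sub hwh u)
          exact ⟨hxX, by rw [(H.simp V hV).isB.extreme]; exact hxV⟩
        rw [(stel_isB (H.simp V hV) (hwV V hV) hu).extreme] at h1
        exact h1
      · simp [stel]
  · intro x hx
    obtain ⟨V, hV, hxV⟩ := H.cover x hx
    by_cases hw : w ∈ hull d V
    · obtain ⟨u, hu, hxu⟩ := stel_cover (H.simp V hV) hw (hwV V hV) hxV
      exact ⟨_, mem_refi.2 (Or.inr ⟨V, hV, hw, u, hu, rfl⟩), hxu⟩
    · exact ⟨V, mem_refi.2 (Or.inl ⟨hV, hw⟩), hxV⟩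

lemma Tri.refi_card (H : Tri d P C) (hwP : w ∈ interior P) (hwV : ∀ V ∈ C, w ∉ V) :
    C.card + d ≤ (refi d w C).card := by
  classical
  have hw1 : ∀ V ∈ C, w ∈ hull d V → 2 ≤ (carr d w V).card := by
    intro V hV hw
    obtain ⟨a, ha, _⟩ := other (H.simp V hV) hw (hwV V hV) 0
    obtain ⟨b, hb, hba⟩ := other (H.simp V hV) hw (hwV V hV) a
    exact Finset.one_lt_card.2 ⟨b, hb, a, ha, hba⟩
  have hcard : (refi d w C).card = (C.filter fun V => w ∉ hull d V).card +
      ∑ V ∈ C.filter (fun V => w ∈ hull d V), (carr d w V).card := by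
    unfold refi
    rw [Finset.card_union_of_disjoint, Finset.card_biUnion]
    · congr 1
      refine Finset.sum_congr (by congr) fun V hV => ?_
      rw [Finset.card_image_of_injOn]
      intro a ha b hb e
      have hV := (Finset.mem_filter.1 hV)
      by_contra hab
      have : a ∈ stel d w V b := by simp [stel, hab, (mem_carr.1 ha).1]
      rw [← e] at this
      simp only [stel, Finset.mem_insert, Finset.mem_erase, ne_eq, not_true, false_and, or_false] at this
      exact hwV V hV.1 (this ▸ (mem_carr.1 ha).1)
    · intro V hV V' hV' hne
      have hV := (Finset.mem_filter.1 hV)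
      have hV' := (Finset.mem_filter.1 hV')
      rw [Function.onFun, Finset.disjoint_left]
      intro X hX hX'
      obtain ⟨a, ha, rfl⟩ := Finset.mem_image.1 hX
      obtain ⟨b, hb, e⟩ := Finset.mem_image.1 hX'
      obtain ⟨z, hz⟩ := (stel_isB (H.simp V hV.1) (hwV V hV.1) ha).int_ne
      have h1 := interior_mono (stel_sub hV.2 a) hz
      rw [← e] at hz
      exact hne (H.M hV'.1 hV.1 h1 (stel_sub hV'.2 b (interior_subset hz)))
    · rw [Finset.disjoint_left]
      intro X hX hX'
      obtain ⟨V, hV, hX'⟩ := Finset.mem_biUnion.1 hX'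
      obtain ⟨a, ha, rfl⟩ := Finset.mem_image.1 hX'
      exact hwV _ (Finset.mem_filter.1 hX).1 (by simp [stel])
  have hsplit := Finset.card_filter_add_card_filter_not (s := C) (fun V => w ∈ hull d V)
  obtain ⟨V0, hV0, hw0⟩ := H.cover w (interior_subset hwP)
  have hnb : ∀ y ∈ V0 \ carr d w V0, ∃ V' ∈ C, V' ≠ V0 ∧ V0.erase y ⊆ V' ∧ w ∈ hull d V' ∧
      carr d w V' = carr d w V0 := by
    intro y hy
    have hy := Finset.mem_sdiff.1 hy
    obtain ⟨_, V', hV', hne, v', hv', e, hwV', hcarr⟩ := H.neighbor hwP hV0 hw0 hy.1 hy.2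
    exact ⟨V', hV', hne, e ▸ Finset.erase_subset _ _, hwV', hcarr⟩
  choose! g hg1 hg2 hg3 hg4 hg5 using hnb
  set N := insert V0 ((V0 \ carr d w V0).image g) with hN
  have hNB : N ⊆ C.filter (fun V => w ∈ hull d V) := by
    intro X hX
    rcases Finset.mem_insert.1 hX with rfl | hX
    · exact Finset.mem_filter.2 ⟨hV0, hw0⟩
    · obtain ⟨y, hy, rfl⟩ := Finset.mem_image.1 hX
      exact Finset.mem_filter.2 ⟨hg1 y hy, hg4 y hy⟩
  have hNc : ∀ X ∈ N, carr d w X = carr d w V0 := by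
    intro X hX
    rcases Finset.mem_insert.1 hX with rfl | hX
    · rfl
    · obtain ⟨y, hy, rfl⟩ := Finset.mem_image.1 hX
      exact hg5 y hy
  have hVc := (H.simp V0 hV0).isB.1
  have hsub : carr d w V0 ⊆ V0 := Finset.filter_subset _ _
  have hle := Finset.card_le_card hsub
  have hNcard : N.card = (d + 1 - (carr d w V0).card) + 1 := by
    rw [hN, Finset.card_insert_of_notMem, Finset.card_image_of_injOn, Finset.card_sdiff_of_subset hsub, hVc]
    · intro a ha b hb e
      by_contra hab
      apply hg2 a ha
      symm
      apply Finset.eq_of_subset_of_card_le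
      · intro x hx
        by_cases hxa : x = a
        · rw [e]
          exact hg3 b hb (Finset.mem_erase.2 ⟨hxa ▸ hab, hx⟩)
        · exact hg3 a ha (Finset.mem_erase.2 ⟨hxa, hx⟩)
      · rw [hVc, (H.simp _ (hg1 a ha)).isB.1]
    · intro hX
      obtain ⟨y, hy, e⟩ := Finset.mem_image.1 hX
      exact hg2 y hy e
  have h2 := hw1 V0 hV0 hw0
  obtain ⟨k, hk⟩ : ∃ k, (carr d w V0).card = k + 1 := ⟨_, (Nat.sub_add_cancel (by omega)).symm⟩
  have hsum : (C.filter fun V => w ∈ hull d V).card + N.card * k ≤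
      ∑ V ∈ C.filter (fun V => w ∈ hull d V), (carr d w V).card := by
    have e1 : ∑ V ∈ C.filter (fun V => w ∈ hull d V), (carr d w V).card =
        ∑ V ∈ C.filter (fun V => w ∈ hull d V), (1 + ((carr d w V).card - 1)) := by
      refine Finset.sum_congr rfl fun V hV => ?_
      have := hw1 V (Finset.mem_filter.1 hV).1 (Finset.mem_filter.1 hV).2
      omega
    rw [e1, Finset.sum_add_distrib, Finset.sum_const, smul_eq_mul, mul_one]
    apply Nat.add_le_add_left
    refine le_trans ?_ (Finset.sum_le_sum_of_subset hNB)
    rw [Finset.sum_congr rfl (fun X hX => by rw [hNc X hX, hk]), Finset.sum_const, smul_eq_mul]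
    simp
  obtain ⟨m, hm⟩ : ∃ m, d = k + m := ⟨d - k, by omega⟩
  have hN2 : N.card = m + 1 := by omega
  have hk1 : 1 ≤ k := by omega
  have : d ≤ N.card * k := by
    rw [hN2, hm]; nlinarith
  omega

end refine_sec

/-- A partial lattice triangulation `𝒯` of a clean non-empty lattice
`d`-polytope `P` can be refined at any interior lattice point `w ∉ 𝒱(𝒯)` into a
lattice triangulation `𝒯'` with `𝒱(𝒯') = 𝒱(𝒯) ∪ {w}`, each member of `𝒯'` inside
a member of `𝒯`, and `|𝒯'| ≥ |𝒯| + d`. -/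
theorem refinement_exists (d : ℕ) (P : Set (Fin d → ℝ))
    (hP : IsLatticePolytope d P) (hclean : IsClean d P)
    (hne : ∃ x ∈ interior P, IsLatticePt d x)
    (𝒯 : Set (Set (Fin d → ℝ))) (h𝒯 : IsLatticeTriangulation d P 𝒯)
    (w : Fin d → ℝ) (hw : w ∈ interior P) (hwl : IsLatticePt d w)
    (hw𝒯 : w ∉ triVertices d 𝒯) :
    ∃ 𝒯' : Set (Set (Fin d → ℝ)),
      IsLatticeTriangulation d P 𝒯' ∧
      triVertices d 𝒯' = triVertices d 𝒯 ∪ {w} ∧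
      (∀ T' ∈ 𝒯', ∃ T ∈ 𝒯, T' ⊆ T) ∧
      𝒯.ncard + d ≤ 𝒯'.ncard := by
  obtain ⟨C, rfl, H⟩ := exists_C h𝒯
  have hwV : ∀ V ∈ C, w ∉ V := fun V hV hh => hw𝒯 ((triVertices_eq H.simp w).2 ⟨V, hV, hh⟩)
  have H' := H.refi_tri hw hwl hwV
  refine ⟨hull d '' (refi d w C), (tri_iff H'.simp H'.lat).2 H', ?_, ?_, ?_⟩
  · ext x
    rw [Set.mem_union, triVertices_eq H'.simp, triVertices_eq H.simp, H.refi_vert hw hwV]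
    simp
  · rintro _ ⟨X, hX, rfl⟩
    obtain ⟨V, hV, hs⟩ := Tri.refi_parent hX
    exact ⟨_, ⟨V, hV, rfl⟩, hs⟩
  · rw [H.ncard, H'.ncard]
    exact H.refi_card hw hwV
end
end

section
/- Let d ≥ 2, k ≥ 0, and let T ⊂ ℝ^d be a clean lattice d-simplex whose interior contains exactly k lattice points. Then there exists a full lattice triangulation 𝒯 of T (one with 𝒱(𝒯) = T ∩ ℤ^d) such that |𝒯| ≥ dk + 1; consequently Vol(T) ≥ (dk + 1)/d!. -/
open MeasureTheory Set
open scoped ENNReal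

noncomputable section

section Aux
open Classical Finset

/-- `w` is a convex weight function supported on `s` representing `x`. -/
def WRep {d : ℕ} (s : Finset (Fin d → ℝ)) (x : Fin d → ℝ) (w : (Fin d → ℝ) → ℝ) : Prop :=
  (∀ v, 0 ≤ w v) ∧ (∀ v, v ∉ s → w v = 0) ∧ ∑ v ∈ s, w v = 1 ∧ ∑ v ∈ s, w v • v = x

/-- The geometric realisation of a vertex set. -/
def cv {d : ℕ} (s : Finset (Fin d → ℝ)) : Set (Fin d → ℝ) := convexHull ℝ (s : Set (Fin d → ℝ))

/-- Unique representability across a family of vertex sets. -/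
def Good {d : ℕ} (S : Finset (Finset (Fin d → ℝ))) : Prop :=
  ∀ s ∈ S, ∀ t ∈ S, ∀ x w w', WRep s x w → WRep t x w' → w = w'

variable {d : ℕ} {s t : Finset (Fin d → ℝ)} {x y : Fin d → ℝ} {w w' : (Fin d → ℝ) → ℝ}

lemma mem_cv_iff : x ∈ cv s ↔ ∃ w, WRep s x w := by
  unfold cv WRep
  rw [Finset.mem_convexHull']
  constructor
  · rintro ⟨w, h0, h1, h2⟩
    refine ⟨fun v => if v ∈ s then w v else 0, ?_, ?_, ?_, ?_⟩
    · intro v; dsimp only; split_ifs with h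
      · exact h0 v h
      · exact le_rfl
    · intro v hv; simp [hv]
    · rw [← h1]; exact sum_congr rfl (fun v hv => by simp [hv])
    · rw [← h2]; exact sum_congr rfl (fun v hv => by simp [hv])
  · rintro ⟨w, h0, -, h1, h2⟩
    exact ⟨w, fun y _ => h0 y, h1, h2⟩

lemma WRep.mem (h : WRep s x w) : x ∈ cv s := mem_cv_iff.2 ⟨w, h⟩

lemma WRep.transfer (h : WRep t x w) (hs : ∀ v, v ∉ s → w v = 0) : WRep s x w := by
  obtain ⟨h0, h1, h2, h3⟩ := h
  refine ⟨h0, hs, ?_, ?_⟩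
  · rw [← h2, sum_subset (subset_union_left (s₁ := s) (s₂ := t)) (fun v _ hv => hs v hv),
      sum_subset (subset_union_right (s₁ := s) (s₂ := t)) (fun v _ hv => h1 v hv)]
  · rw [← h3, sum_subset (subset_union_left (s₁ := s) (s₂ := t)) (fun v _ hv => by simp [hs v hv]),
      sum_subset (subset_union_right (s₁ := s) (s₂ := t)) (fun v _ hv => by simp [h1 v hv])]

lemma WRep.mono (h : WRep s x w) (hst : s ⊆ t) : WRep t x w :=
  h.transfer (fun v hv => h.2.1 v (fun h' => hv (hst h')))

lemma WRep.combo (h : WRep s x w) (h' : WRep s y w') {a b : ℝ} (ha : 0 ≤ a) (hb : 0 ≤ b)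
    (hab : a + b = 1) : WRep s (a • x + b • y) (fun v => a * w v + b * w' v) := by
  refine ⟨fun v => ?_, fun v hv => ?_, ?_, ?_⟩
  · have := h.1 v; have := h'.1 v; positivity
  · simp [h.2.1 v hv, h'.2.1 v hv]
  · rw [sum_add_distrib, ← mul_sum, ← mul_sum, h.2.2.1, h'.2.2.1]; linarith
  · rw [← h.2.2.2, ← h'.2.2.2, smul_sum, smul_sum, ← sum_add_distrib]
    exact sum_congr rfl (fun v _ => by rw [add_smul, mul_smul, mul_smul])

lemma rep_single {v : Fin d → ℝ} (hv : v ∈ s) : WRep s v (fun z => if z = v then 1 else 0) := by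
  refine ⟨fun z => ?_, fun z hz => ?_, ?_, ?_⟩
  · dsimp only; split_ifs <;> norm_num
  · have : z ≠ v := by rintro rfl; exact hz hv
    simp [this]
  · simp [hv]
  · simp [hv]

lemma WRep.of_single {v : Fin d → ℝ} (h : WRep s x w) (hs : ∀ z, z ≠ v → w z = 0) : x = v := by
  have h1 : WRep {v} x w := h.transfer (by simpa using hs)
  have h2 := h1.2.2.1
  have h3 := h1.2.2.2
  simp at h2 h3
  rw [← h3, h2, one_smul]

lemma cv_mono (h : s ⊆ t) : cv s ⊆ cv t := convexHull_mono (by exact_mod_cast h)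

lemma isClosed_cv (s : Finset (Fin d → ℝ)) : IsClosed (cv s) :=
  s.finite_toSet.isClosed_convexHull ℝ

lemma mem_cv_self {v : Fin d → ℝ} (h : v ∈ s) : v ∈ cv s := subset_convexHull ℝ _ (by exact_mod_cast h)

lemma Good.single {S : Finset (Finset (Fin d → ℝ))} (hS : Good S) (hs : s ∈ S) : Good {s} := by
  intro a ha b hb
  rw [Finset.mem_singleton] at ha hb
  subst ha; subst hb
  exact hS _ hs _ hs

lemma Good.sub (hS : Good {s}) (hst : t ⊆ s) : Good {t} := by
  intro a ha b hb x w w' h h'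
  rw [Finset.mem_singleton] at ha hb
  subst ha; subst hb
  exact hS s (by simp) s (by simp) x w w' (h.mono hst) (h'.mono hst)

lemma Good.uniq (hS : Good {s}) (h : WRep s x w) (h' : WRep s x w') : w = w' :=
  hS s (by simp) s (by simp) x w w' h h'

lemma ext_cv (hS : Good {s}) : Set.extremePoints ℝ (cv s) = (s : Set (Fin d → ℝ)) := by
  apply Set.Subset.antisymm
  · exact extremePoints_convexHull_subset
  · intro v hv
    have hv : v ∈ s := by exact_mod_cast hv
    rw [mem_extremePoints]
    refine ⟨mem_cv_self hv, ?_⟩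
    rintro x hx y hy ⟨a, b, ha, hb, hab, he⟩
    obtain ⟨w, hw⟩ := mem_cv_iff.1 hx
    obtain ⟨w', hw'⟩ := mem_cv_iff.1 hy
    have h1 := hw.combo hw' ha.le hb.le hab
    rw [he] at h1
    have h2 := hS.uniq h1 (rep_single hv)
    have key : ∀ z, z ≠ v → w z = 0 ∧ w' z = 0 := by
      intro z hz
      have h3 := congrFun h2 z
      simp only [hz, if_false] at h3
      have e1 := mul_nonneg ha.le (hw.1 z)
      have e2 := mul_nonneg hb.le (hw'.1 z)
      have e3 : a * w z = 0 := by linarith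
      have e4 : b * w' z = 0 := by linarith
      exact ⟨(mul_eq_zero.1 e3).resolve_left ha.ne', (mul_eq_zero.1 e4).resolve_left hb.ne'⟩
    exact ⟨hw.of_single (fun z hz => (key z hz).1), hw'.of_single (fun z hz => (key z hz).2)⟩

/-- Affine independence in terms of sums. -/
def AI (s : Finset (Fin d → ℝ)) : Prop :=
  ∀ c : (Fin d → ℝ) → ℝ, ∑ v ∈ s, c v = 0 → ∑ v ∈ s, c v • v = 0 → ∀ v ∈ s, c v = 0

lemma AI.good (h : AI s) : Good {s} := by
  intro a ha b hb x w w' hw hw'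
  rw [Finset.mem_singleton] at ha hb
  subst ha; subst hb
  funext v
  by_cases hv : v ∈ b
  · have := h (fun v => w v - w' v) (by rw [sum_sub_distrib, hw.2.2.1, hw'.2.2.1, sub_self])
      (by simp only [sub_smul]; rw [sum_sub_distrib, hw.2.2.2, hw'.2.2.2, sub_self]) v hv
    exact sub_eq_zero.1 this
  · rw [hw.2.1 v hv, hw'.2.1 v hv]

lemma Good.ai (h : Good {s}) : AI s := by
  intro c hc1 hc2
  set m := ∑ v ∈ s, max (c v) 0 with hm
  have e : ∀ v, max (c v) 0 - max (-c v) 0 = c v := by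
    intro v; rcases le_total (c v) 0 with h | h
    · rw [max_eq_right h, max_eq_left (by linarith)]; ring
    · rw [max_eq_left h, max_eq_right (by linarith)]; ring
  have hm' : ∑ v ∈ s, max (-c v) 0 = m := by
    have : ∑ v ∈ s, (max (c v) 0 - max (-c v) 0) = 0 := (sum_congr rfl (fun v _ => e v)).trans hc1
    rw [sum_sub_distrib] at this; linarith
  have hx' : ∑ v ∈ s, max (-c v) 0 • v = ∑ v ∈ s, max (c v) 0 • v := by
    have : ∑ v ∈ s, (max (c v) 0 - max (-c v) 0) • v = 0 :=
      (sum_congr rfl (fun v _ => by rw [e v])).trans hc2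
    simp only [sub_smul] at this
    rw [sum_sub_distrib] at this; exact (sub_eq_zero.1 this).symm
  have hm0 : 0 ≤ m := sum_nonneg (fun v _ => le_max_right _ _)
  rcases hm0.eq_or_lt with h0 | hpos
  · intro v hv
    have h1 := (sum_eq_zero_iff_of_nonneg (fun v _ => le_max_right (c v) 0)).1 (hm ▸ h0.symm) v hv
    have h2 := (sum_eq_zero_iff_of_nonneg (fun v _ => le_max_right (-c v) 0)).1 (hm'.trans h0.symm) v hv
    rw [← e v, h1, h2, sub_self]
  · have gen : ∀ f : (Fin d → ℝ) → ℝ, (∀ v, 0 ≤ f v) → ∑ v ∈ s, f v = m →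
        WRep s (m⁻¹ • ∑ v ∈ s, f v • v) (fun v => if v ∈ s then m⁻¹ * f v else 0) := by
      intro f hf hs
      refine ⟨fun v => ?_, fun v hv => by simp [hv], ?_, ?_⟩
      · dsimp only; split_ifs
        · have := hf v; positivity
        · exact le_rfl
      · rw [sum_congr rfl (fun v hv => if_pos hv), ← mul_sum, hs, inv_mul_cancel₀ hpos.ne']
      · rw [smul_sum]; exact sum_congr rfl (fun v hv => by simp [hv, mul_smul])
    have r1 := gen (fun v => max (c v) 0) (fun v => le_max_right _ _) rfl
    have r2 := gen (fun v => max (-c v) 0) (fun v => le_max_right _ _) hm'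
    rw [hx'] at r2
    intro v hv
    have := congrFun (h.uniq r1 r2) v
    simp only [hv, if_true] at this
    have := mul_left_cancel₀ (inv_pos.2 hpos).ne' this
    rw [← e v, this, sub_self]


/-- The working notion of a triangulation. -/
structure Tri_s17 (T : Set (Fin d → ℝ)) (S : Finset (Finset (Fin d → ℝ))) : Prop where
  card : ∀ s ∈ S, s.card = d + 1
  good : Good S
  cover : ∀ x, x ∈ T ↔ ∃ s ∈ S, x ∈ cv s

lemma small_step {U : Set (Fin d → ℝ)} (hU : IsOpen U) {q : Fin d → ℝ} (hq : q ∈ U)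
    (c : Fin d → ℝ) : ∃ ε : ℝ, 0 < ε ∧ ε < 1 ∧ (1 - ε) • q + ε • c ∈ U := by
  have hcont : Continuous (fun ε : ℝ => (1 - ε) • q + ε • c) := by fun_prop
  have h0 : (0 : ℝ) ∈ (fun ε : ℝ => (1 - ε) • q + ε • c) ⁻¹' U := by simpa using hq
  obtain ⟨r, hr, hb⟩ := Metric.isOpen_iff.1 (hU.preimage hcont) 0 h0
  refine ⟨min (r / 2) (1 / 2), by positivity, ?_, ?_⟩
  · exact lt_of_le_of_lt (min_le_right _ _) (by norm_num)
  · apply hb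
    rw [Metric.mem_ball, Real.dist_eq, sub_zero, abs_of_pos (by positivity)]
    exact lt_of_le_of_lt (min_le_left _ _) (by linarith)

lemma wrep_center (hs : s.Nonempty) : ∃ c w, WRep s c w ∧ ∀ v ∈ s, 0 < w v := by
  have hn : (0 : ℝ) < s.card := by exact_mod_cast hs.card_pos
  refine ⟨∑ v ∈ s, (if v ∈ s then (1 / s.card : ℝ) else 0) • v,
    fun v => if v ∈ s then (1 / s.card : ℝ) else 0, ⟨?_, ?_, ?_, rfl⟩, ?_⟩
  · intro v; dsimp only; split_ifs
    · positivity
    · exact le_rfl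
  · intro v hv; simp [hv]
  · rw [sum_congr rfl (fun v hv => if_pos hv)]; simp [hn.ne']
  · intro v hv; simp only [hv, if_true]; positivity

lemma WRep.nonempty (h : WRep s x w) : s.Nonempty := by
  rw [Finset.nonempty_iff_ne_empty]; rintro rfl
  simpa using h.2.2.1

lemma facet_exists {T : Set (Fin d → ℝ)} {S : Finset (Finset (Fin d → ℝ))} (hT : Tri_s17 T S)
    (hs : s ∈ S) {u q : Fin d → ℝ} (hu : u ∈ s) (hq : q ∈ cv (s.erase u)) (hqi : q ∈ interior T) :
    ∃ t ∈ S, t ≠ s ∧ s.erase u ⊆ t := by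
  obtain ⟨ρ, hρ⟩ := mem_cv_iff.1 hq
  obtain ⟨c, κ, hκ, hκpos⟩ := wrep_center hρ.nonempty
  obtain ⟨ε, he0, he1, hy⟩ := small_step isOpen_interior hqi c
  set y := (1 - ε) • q + ε • c with hydef
  have hω := hρ.combo hκ (by linarith : 0 ≤ 1 - ε) he0.le (by ring)
  rw [← hydef] at hω
  set ω : (Fin d → ℝ) → ℝ := fun v => (1 - ε) * ρ v + ε * κ v with hωdef
  have hωpos : ∀ v ∈ s.erase u, 0 < ω v := by
    intro v hv
    have := hρ.1 v; have := hκpos v hv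
    have h1 : 0 ≤ (1 - ε) * ρ v := mul_nonneg (by linarith) (by assumption)
    have h2 : 0 < ε * κ v := by positivity
    simp only [hωdef]; linarith
  have hK : IsClosed (⋃ t ∈ S.filter (fun t => y ∉ cv t), cv t) :=
    isClosed_biUnion_finset (fun t _ => isClosed_cv t)
  have hyU : y ∈ interior T ∩ (⋃ t ∈ S.filter (fun t => y ∉ cv t), cv t)ᶜ := by
    refine ⟨hy, ?_⟩
    simp
  obtain ⟨δ, hδ0, hδ1, hz⟩ := small_step (isOpen_interior.inter hK.isOpen_compl) hyU ((2 : ℝ) • y - u)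
  set z := (1 - δ) • y + δ • ((2 : ℝ) • y - u) with hzdef
  obtain ⟨t, ht, hzt⟩ := (hT.cover z).1 (interior_subset hz.1)
  have hyt : y ∈ cv t := by
    by_contra hcon
    apply hz.2
    simp only [Set.mem_iUnion]
    exact ⟨t, by simp [ht, hcon], hzt⟩
  have hωs := hω.mono (erase_subset u s)
  refine ⟨t, ht, ?_, ?_⟩
  · rintro rfl
    obtain ⟨ζ, hζ⟩ := mem_cv_iff.1 hzt
    have h1 := hζ.combo (rep_single hu) (a := 1 / (1 + δ)) (b := δ / (1 + δ)) (by positivity)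
      (by positivity) (by field_simp)
    have h2 : (1 / (1 + δ)) • z + (δ / (1 + δ)) • u = y := by
      have h3 : z = (1 + δ) • y - δ • u := by rw [hzdef]; module
      have h4 : (1 / (1 + δ)) * (1 + δ) = 1 := by field_simp
      rw [h3, smul_sub, smul_smul, smul_smul, h4]
      have h5 : 1 / (1 + δ) * δ = δ / (1 + δ) := by ring
      rw [h5]; module
    rw [h2] at h1
    have h3 := congrFun (hT.good t hs t hs _ _ _ h1 hωs) u
    rw [hω.2.1 u (by simp)] at h3
    simp only [if_true] at h3
    have := hζ.1 u
    have h4 : 0 ≤ 1 / (1 + δ) * ζ u := by positivity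
    have h5 : 0 < δ / (1 + δ) * 1 := by positivity
    linarith
  · intro v hv
    obtain ⟨ω', hω'⟩ := mem_cv_iff.1 hyt
    have h3 := hT.good s hs t ht _ _ _ hωs hω'
    by_contra hvt
    have := hωpos v hv
    rw [h3, hω'.2.1 v hvt] at this
    exact lt_irrefl _ this

lemma interior_disj {S : Finset (Finset (Fin d → ℝ))} (hS : Good S) (hs : s ∈ S) (ht : t ∈ S)
    (hc : s.card = t.card) (hst : s ≠ t) : interior (cv s) ∩ interior (cv t) = ∅ := by
  rw [Set.eq_empty_iff_forall_notMem]
  rintro x ⟨hxs, hxt⟩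
  obtain ⟨u, hu, hut⟩ : ∃ u ∈ s, u ∉ t := by
    by_contra! hcon
    exact hst (Finset.eq_of_subset_of_card_le hcon hc.ge)
  obtain ⟨ε, he0, he1, hy⟩ := small_step isOpen_interior hxt u
  obtain ⟨w, hw⟩ := mem_cv_iff.1 (interior_subset hxs)
  obtain ⟨w', hw'⟩ := mem_cv_iff.1 (interior_subset hy)
  have h1 := hw.combo (rep_single hu) (by linarith : 0 ≤ 1 - ε) he0.le (by ring)
  have h2 := congrFun (hS s hs t ht _ _ _ h1 hw') u
  rw [hw'.2.1 u hut] at h2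
  simp only [if_true] at h2
  have := mul_nonneg (by linarith : 0 ≤ 1 - ε) (hw.1 u)
  linarith

lemma WRep.sharp {p u : Fin d → ℝ} {α π : (Fin d → ℝ) → ℝ} (h : WRep (insert p (s.erase u)) x α)
    (hp : WRep s p π) (hps : p ∉ s) (hu : u ∈ s) :
    WRep s x (fun v => if v = p then 0 else α v + α p * π v) := by
  have hne : ∀ v ∈ s, v ≠ p := by rintro v hv rfl; exact hps hv
  have hup : u ≠ p := hne u hu
  have hαu : α u = 0 := h.2.1 u (by simp [hup])
  have hpe : p ∉ s.erase u := by simp [hps]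
  have e1 : α p + ∑ v ∈ s, α v = 1 := by
    rw [← h.2.2.1, sum_insert hpe, ← add_sum_erase s α hu, hαu, zero_add]
  have e2 : α p • p + ∑ v ∈ s, α v • v = x := by
    rw [← h.2.2.2, sum_insert hpe, ← add_sum_erase s (fun v => α v • v) hu, hαu, zero_smul, zero_add]
  refine ⟨fun v => ?_, fun v hv => ?_, ?_, ?_⟩
  · dsimp only; split_ifs
    · exact le_rfl
    · have := h.1 v; have := h.1 p; have := hp.1 v; positivity
  · dsimp only; split_ifs with hvp
    · rfl
    · rw [h.2.1 v (by simp [hvp, hv]), hp.2.1 v hv]; ring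
  · rw [sum_congr rfl (fun v hv => if_neg (hne v hv)), sum_add_distrib, ← mul_sum, hp.2.2.1]
    linarith
  · have : ∀ v ∈ s, (if v = p then (0 : ℝ) else α v + α p * π v) • v = α v • v + α p • π v • v := by
      intro v hv; rw [if_neg (hne v hv), add_smul, mul_smul]
    rw [sum_congr rfl this, sum_add_distrib, ← smul_sum, hp.2.2.2, add_comm]
    exact e2

lemma WRep.unsharp {p : Fin d → ℝ} {π : (Fin d → ℝ) → ℝ} (h : WRep s x w)
    (hp : WRep s p π) (hps : p ∉ s) : ∃ u ∈ s, 0 < π u ∧ x ∈ cv (insert p (s.erase u)) := by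
  have hne : ∀ v ∈ s, v ≠ p := by rintro v hv rfl; exact hps hv
  have hFne : (s.filter (fun u => 0 < π u)).Nonempty := by
    by_contra hcon
    rw [Finset.not_nonempty_iff_eq_empty, filter_eq_empty_iff] at hcon
    have : ∑ v ∈ s, π v = 0 := sum_eq_zero (fun v hv => le_antisymm (not_lt.1 (hcon hv)) (hp.1 v))
    rw [hp.2.2.1] at this; norm_num at this
  obtain ⟨u, hu, hmin⟩ := exists_min_image _ (fun u => w u / π u) hFne
  rw [Finset.mem_filter] at hu
  obtain ⟨hus, hupos⟩ := hu
  refine ⟨u, hus, hupos, mem_cv_iff.2 ?_⟩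
  set l := w u / π u with hl
  have hl0 : 0 ≤ l := div_nonneg (h.1 u) hupos.le
  have hlu : w u - l * π u = 0 := by rw [hl]; field_simp; ring
  have hpe : p ∉ s.erase u := by simp [hps]
  have hne' : ∀ v ∈ s.erase u, v ≠ p := fun v hv => hne v (mem_of_mem_erase hv)
  refine ⟨fun v => if v = p then l else w v - l * π v, fun v => ?_, fun v hv => ?_, ?_, ?_⟩
  · dsimp only; split_ifs
    · exact hl0
    · rcases (hp.1 v).eq_or_lt with h0 | h0
      · rw [← h0]; simpa using h.1 v
      · have hvs : v ∈ s := by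
          by_contra hvs; rw [hp.2.1 v hvs] at h0; exact lt_irrefl _ h0
        have := hmin v (by simp [hvs, h0])
        rw [le_div_iff₀ h0] at this
        linarith
  · simp only [Finset.mem_insert, mem_erase, not_or, not_and] at hv
    dsimp only; rw [if_neg hv.1]
    by_cases hvu : v = u
    · rw [hvu]; exact hlu
    · rw [h.2.1 v (hv.2 hvu), hp.2.1 v (hv.2 hvu)]; ring
  · rw [sum_insert hpe, sum_congr rfl (fun v hv => if_neg (hne' v hv)), if_pos rfl]
    have := add_sum_erase s (fun v => w v - l * π v) hus
    simp only [hlu, zero_add] at this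
    rw [this, sum_sub_distrib, ← mul_sum, h.2.2.1, hp.2.2.1]; ring
  · have : ∀ v ∈ s.erase u, (if v = p then l else w v - l * π v) • v = (w v - l * π v) • v := by
      intro v hv; rw [if_neg (hne' v hv)]
    rw [sum_insert hpe, sum_congr rfl this]
    simp only [if_true]
    have := add_sum_erase s (fun v => (w v - l * π v) • v) hus
    simp only [hlu, zero_smul, zero_add] at this
    rw [this]
    simp only [sub_smul, mul_smul]
    rw [sum_sub_distrib, ← smul_sum, h.2.2.2, hp.2.2.2]; abel

/-- Stellar subdivision. -/
def sd (S : Finset (Finset (Fin d → ℝ))) (p : Fin d → ℝ) (π : (Fin d → ℝ) → ℝ)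
    (F : Finset (Fin d → ℝ)) : Finset (Finset (Fin d → ℝ)) :=
  S.filter (fun s => ¬ WRep s p π) ∪
    image₂ (fun s u => insert p (s.erase u)) (S.filter (fun s => WRep s p π)) F

section Sub
variable {T : Set (Fin d → ℝ)} {S : Finset (Finset (Fin d → ℝ))} {p : Fin d → ℝ}
  {π : (Fin d → ℝ) → ℝ} {F : Finset (Fin d → ℝ)}

lemma mem_sd : t ∈ sd S p π F ↔ (t ∈ S ∧ ¬ WRep t p π) ∨
    ∃ s ∈ S, WRep s p π ∧ ∃ u ∈ F, insert p (s.erase u) = t := by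
  unfold sd
  simp only [Finset.mem_union, Finset.mem_filter, Finset.mem_image₂, and_assoc]

lemma supp_sub (hF : ∀ u, u ∈ F ↔ 0 < π u) (h : WRep s p π) : F ⊆ s := by
  intro u hu
  by_contra hus
  have := (hF u).1 hu
  rw [h.2.1 u hus] at this
  exact lt_irrefl _ this

lemma sd_mixed (hS : Good S) (hpS : ∀ s ∈ S, p ∉ s) (hs : s ∈ S) (ht : t ∈ S)
    {u : Fin d → ℝ} {α β : (Fin d → ℝ) → ℝ} (hu : u ∈ s) (hsp : WRep s p π) (htp : ¬ WRep t p π)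
    (hα : WRep (insert p (s.erase u)) x α) (hβ : WRep t x β) : α = β := by
  have h1 := hS s hs t ht _ _ _ (hα.sharp hsp (hpS s hs) hu) hβ
  have hα0 : α p = 0 := by
    by_contra hne
    have hpos : 0 < α p := lt_of_le_of_ne (hα.1 p) (Ne.symm hne)
    apply htp
    apply hsp.transfer
    intro v hv
    by_cases hvp : v = p
    · rw [hvp]; exact hsp.2.1 p (hpS s hs)
    have h2 := congrFun h1 v
    simp only [hvp, if_false] at h2
    rw [hβ.2.1 v hv] at h2
    have h3 := hα.1 v
    have h4 := mul_nonneg hpos.le (hsp.1 v)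
    have h5 : α p * π v = 0 := by linarith
    exact (mul_eq_zero.1 h5).resolve_left hne
  funext v
  have h2 := congrFun h1 v
  by_cases hvp : v = p
  · rw [hvp, hα0, hβ.2.1 p (hpS t ht)]
  · simpa only [hvp, if_false, hα0, zero_mul, add_zero] using h2

lemma sd_both (hS : Good S) (hpS : ∀ s ∈ S, p ∉ s) (hs : s ∈ S) (ht : t ∈ S)
    {u z : Fin d → ℝ} {α β : (Fin d → ℝ) → ℝ} (hu : 0 < π u) (hz : 0 < π z)
    (hus : u ∈ s) (hzt : z ∈ t) (hsp : WRep s p π) (htp : WRep t p π)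
    (hα : WRep (insert p (s.erase u)) x α) (hβ : WRep (insert p (t.erase z)) x β) : α = β := by
  have h1 := hS s hs t ht _ _ _ (hα.sharp hsp (hpS s hs) hus) (hβ.sharp htp (hpS t ht) hzt)
  have hup : u ≠ p := by rintro rfl; exact hpS s hs hus
  have hzp : z ≠ p := by rintro rfl; exact hpS t ht hzt
  have hαu : α u = 0 := hα.2.1 u (by simp [hup])
  have hβz : β z = 0 := hβ.2.1 z (by simp [hzp])
  have a1 := congrFun h1 u
  have a2 := congrFun h1 z
  simp only [hup, hzp, if_false, hαu, hβz, zero_add] at a1 a2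
  have b1 : β p ≤ α p := by
    have := hβ.1 u
    have : β p * π u ≤ α p * π u := by linarith
    exact le_of_mul_le_mul_right this hu
  have b2 : α p ≤ β p := by
    have := hα.1 z
    have : α p * π z ≤ β p * π z := by linarith
    exact le_of_mul_le_mul_right this hz
  have b : α p = β p := le_antisymm b2 b1
  funext v
  by_cases hvp : v = p
  · rw [hvp, b]
  · have h2 := congrFun h1 v
    simp only [hvp, if_false, b] at h2
    linarith

lemma sd_tri (hT : Tri_s17 T S) (hpS : ∀ s ∈ S, p ∉ s) (hF : ∀ u, u ∈ F ↔ 0 < π u) :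
    Tri_s17 T (sd S p π F) := by
  refine ⟨?_, ?_, ?_⟩
  · intro t ht
    rcases mem_sd.1 ht with ⟨h, -⟩ | ⟨s, hs, hsp, u, hu, rfl⟩
    · exact hT.card t h
    · have := supp_sub hF hsp hu
      rw [card_insert_of_notMem (by simp [hpS s hs]), card_erase_of_mem this, hT.card s hs]
      rfl
  · intro a ha b hb x w w' hw hw'
    rcases mem_sd.1 ha with ⟨h1, h1'⟩ | ⟨s, hs, hsp, u, hu, rfl⟩ <;>
    rcases mem_sd.1 hb with ⟨h2, h2'⟩ | ⟨t, ht, htp, z, hz, rfl⟩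
    · exact hT.good a h1 b h2 x w w' hw hw'
    · exact (sd_mixed hT.good hpS ht h1 (supp_sub hF htp hz) htp h1' hw' hw).symm
    · exact sd_mixed hT.good hpS hs h2 (supp_sub hF hsp hu) hsp h2' hw hw'
    · exact sd_both hT.good hpS hs ht ((hF u).1 hu) ((hF z).1 hz) (supp_sub hF hsp hu)
        (supp_sub hF htp hz) hsp htp hw hw'
  · intro x
    rw [hT.cover]
    constructor
    · rintro ⟨s, hs, hx⟩
      by_cases hsp : WRep s p π
      · obtain ⟨w, hw⟩ := mem_cv_iff.1 hx
        obtain ⟨u, hu, hu', hxu⟩ := hw.unsharp hsp (hpS s hs)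
        exact ⟨_, mem_sd.2 (Or.inr ⟨s, hs, hsp, u, (hF u).2 hu', rfl⟩), hxu⟩
      · exact ⟨s, mem_sd.2 (Or.inl ⟨hs, hsp⟩), hx⟩
    · rintro ⟨a, ha, hx⟩
      rcases mem_sd.1 ha with ⟨h1, h1'⟩ | ⟨s, hs, hsp, u, hu, rfl⟩
      · exact ⟨a, h1, hx⟩
      · obtain ⟨w, hw⟩ := mem_cv_iff.1 hx
        exact ⟨s, hs, (hw.sharp hsp (hpS s hs) (supp_sub hF hsp hu)).mem⟩

lemma supp_two (hpS : p ∉ s) (hsp : WRep s p π) (hF : ∀ u, u ∈ F ↔ 0 < π u) : 2 ≤ F.card := by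
  by_contra hcon
  have h1 : F.card ≤ 1 := by omega
  have hz : ∀ v, v ∉ F → π v = 0 := fun v hv =>
    le_antisymm (not_lt.1 (fun h => hv ((hF v).2 h))) (hsp.1 v)
  have hFp := hsp.transfer hz
  obtain ⟨v, hv⟩ := hFp.nonempty
  have h2 := card_le_one.1 h1
  have : p = v := hsp.of_single (v := v) (fun z hzv => hz z (fun h => hzv (h2 z h v hv)))
  exact hpS (this ▸ supp_sub hF hsp hv)

lemma sd_vert (hpS : ∀ s ∈ S, p ∉ s) (hF : ∀ u, u ∈ F ↔ 0 < π u)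
    (hex : ∃ s ∈ S, WRep s p π) (v : Fin d → ℝ) :
    (∃ s ∈ sd S p π F, v ∈ s) ↔ v = p ∨ ∃ s ∈ S, v ∈ s := by
  constructor
  · rintro ⟨a, ha, hv⟩
    rcases mem_sd.1 ha with ⟨h1, h1'⟩ | ⟨s, hs, hsp, u, hu, rfl⟩
    · exact Or.inr ⟨a, h1, hv⟩
    · rcases Finset.mem_insert.1 hv with h | h
      · exact Or.inl h
      · exact Or.inr ⟨s, hs, mem_of_mem_erase h⟩
  · rintro (rfl | ⟨s, hs, hv⟩)
    · obtain ⟨s, hs, hsp⟩ := hex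
      have := supp_two (hpS s hs) hsp hF
      obtain ⟨u, hu⟩ := card_pos.1 (by omega : 0 < F.card)
      exact ⟨_, mem_sd.2 (Or.inr ⟨s, hs, hsp, u, hu, rfl⟩), mem_insert_self _ _⟩
    · by_cases hsp : WRep s p π
      · have := supp_two (hpS s hs) hsp hF
        obtain ⟨u, hu, huv⟩ := exists_mem_ne (by omega : 1 < F.card) v
        exact ⟨_, mem_sd.2 (Or.inr ⟨s, hs, hsp, u, hu, rfl⟩),
          Finset.mem_insert_of_mem (mem_erase.2 ⟨huv.symm, hv⟩)⟩
      · exact ⟨s, mem_sd.2 (Or.inl ⟨hs, hsp⟩), hv⟩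

lemma star_card (hT : Tri_s17 T S) (hpT : p ∈ interior T) (hF : ∀ u, u ∈ F ↔ 0 < π u)
    (hex : ∃ s ∈ S, WRep s p π) :
    d + 2 ≤ (S.filter (fun s => WRep s p π)).card + F.card := by
  obtain ⟨s, hs, hsp⟩ := hex
  have hFs := supp_sub hF hsp
  have hz : ∀ v, v ∉ F → π v = 0 := fun v hv =>
    le_antisymm (not_lt.1 (fun h => hv ((hF v).2 h))) (hsp.1 v)
  have H : ∀ u ∈ s \ F, ∃ t ∈ S, t ≠ s ∧ s.erase u ⊆ t := by
    intro u hu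
    rw [Finset.mem_sdiff] at hu
    have : WRep (s.erase u) p π := hsp.transfer (by
      intro v hv
      by_cases hvs : v ∈ s
      · have : v = u := by
          by_contra hne; exact hv (mem_erase.2 ⟨hne, hvs⟩)
        rw [this]; exact hz u hu.2
      · exact hsp.2.1 v hvs)
    exact facet_exists hT hs hu.1 this.mem hpT
  choose! g hgS hgne hgsub using H
  have hsub : insert s ((s \ F).image g) ⊆ S.filter (fun s => WRep s p π) := by
    intro t ht
    rcases Finset.mem_insert.1 ht with rfl | ht
    · exact Finset.mem_filter.2 ⟨hs, hsp⟩
    · obtain ⟨u, hu, rfl⟩ := Finset.mem_image.1 ht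
      refine Finset.mem_filter.2 ⟨hgS u hu, hsp.transfer ?_⟩
      intro v hv
      apply hz
      intro hvF
      refine hv (hgsub u hu (mem_erase.2 ⟨?_, hFs hvF⟩))
      rintro rfl
      exact (Finset.mem_sdiff.1 hu).2 hvF
  have hinj : Set.InjOn g (s \ F : Finset _) := by
    intro u hu z hz' huz
    have hu : u ∈ s \ F := by exact_mod_cast hu
    have hz' : z ∈ s \ F := by exact_mod_cast hz'
    by_contra hne
    apply hgne u hu
    symm
    apply Finset.eq_of_subset_of_card_le
    · intro v hv
      by_cases hvu : v = u
      · rw [huz]; exact hgsub z hz' (mem_erase.2 ⟨by rw [hvu]; exact hne, hv⟩)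
      · exact hgsub u hu (mem_erase.2 ⟨hvu, hv⟩)
    · rw [hT.card s hs, hT.card _ (hgS u hu)]
  have hnot : s ∉ (s \ F).image g := by
    intro h
    obtain ⟨u, hu, h⟩ := Finset.mem_image.1 h
    exact hgne u hu h
  have h1 := Finset.card_le_card hsub
  rw [card_insert_of_notMem hnot, card_image_of_injOn hinj] at h1
  have h2 := card_sdiff_add_card_eq_card hFs
  have h3 := hT.card s hs
  omega

lemma sd_card (hT : Tri_s17 T S) (hpS : ∀ s ∈ S, p ∉ s) (hpT : p ∈ interior T)
    (hF : ∀ u, u ∈ F ↔ 0 < π u)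
    (hex : ∃ s ∈ S, WRep s p π) : S.card + d ≤ (sd S p π F).card := by
  have hstar := star_card hT hpT hF hex
  obtain ⟨s0, hs0, hsp0⟩ := hex
  have h2 := supp_two (hpS s0 hs0) hsp0 hF
  have h3 : F.card ≤ d + 1 := by rw [← hT.card s0 hs0]; exact Finset.card_le_card (supp_sub hF hsp0)
  unfold sd
  rw [card_union_of_disjoint, card_image₂_iff.2]
  · have h4 := card_filter_add_card_filter_not (s := S) (fun s => WRep s p π)
    set n := (S.filter (fun s => WRep s p π)).card
    set m := (S.filter (fun s => ¬ WRep s p π)).card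
    obtain ⟨j, hj⟩ : ∃ j, F.card = j + 1 := ⟨F.card - 1, by omega⟩
    rw [hj] at hstar h2 h3 ⊢
    obtain ⟨i, rfl⟩ : ∃ i, j = i + 1 := ⟨j - 1, by omega⟩
    obtain ⟨e, he⟩ : ∃ e, d = i + 1 + e := ⟨d - (i+1), by omega⟩
    have h5 : e + 1 ≤ n := by omega
    have h6 := Nat.mul_le_mul_right (i + 1) h5
    have h7 : n * (i + 1 + 1) = n * (i + 1) + n := by ring
    have h8 : (e + 1) * (i + 1) = e * i + e + i + 1 := by ring
    rw [h7]
    have : 0 ≤ e * i := Nat.zero_le _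
    omega
  · rintro ⟨s, u⟩ hsu ⟨t, z⟩ htz h
    simp only [Set.mem_prod, mem_coe, Finset.mem_filter] at hsu htz h
    obtain ⟨⟨hs, hsp⟩, hu⟩ := hsu
    obtain ⟨⟨ht, htp⟩, hz⟩ := htz
    have hup : u ≠ p := by rintro rfl; exact hpS s hs (supp_sub hF hsp hu)
    have he : s.erase u = t.erase z := by
      have := congrArg (fun a => a.erase p) h
      simpa [erase_insert, hpS s hs, hpS t ht] using this
    have huz : u = z := by
      by_contra hne
      have : u ∈ t.erase z := mem_erase.2 ⟨hne, supp_sub hF htp hu⟩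
      rw [← he] at this
      simp at this
    subst huz
    have : s = t := by
      rw [← insert_erase (supp_sub hF hsp hu), he, insert_erase (supp_sub hF htp hz)]
    rw [this]
  · rw [Finset.disjoint_left]
    intro a ha hb
    obtain ⟨s, hs, u, hu, rfl⟩ := Finset.mem_image₂.1 hb
    exact hpS _ (Finset.mem_filter.1 ha).1 (mem_insert_self _ _)

lemma subdivide (hT : Tri_s17 T S) (hpS : ∀ s ∈ S, p ∉ s) (hpT : p ∈ interior T) :
    ∃ S', Tri_s17 T S' ∧ (∀ v, (∃ s ∈ S', v ∈ s) ↔ v = p ∨ ∃ s ∈ S, v ∈ s) ∧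
      S.card + d ≤ S'.card := by
  obtain ⟨s, hs, hps⟩ := (hT.cover p).1 (interior_subset hpT)
  obtain ⟨π, hπ⟩ := mem_cv_iff.1 hps
  have hF : ∀ u, u ∈ s.filter (fun u => 0 < π u) ↔ 0 < π u := by
    intro u
    rw [Finset.mem_filter]
    refine ⟨fun h => h.2, fun h => ⟨?_, h⟩⟩
    by_contra hus
    rw [hπ.2.1 u hus] at h; exact lt_irrefl _ h
  exact ⟨_, sd_tri hT hpS hF, sd_vert hpS hF ⟨s, hs, hπ⟩, sd_card hT hpS hpT hF ⟨s, hs, hπ⟩⟩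

end Sub

lemma tri_iter {T : Set (Fin d → ℝ)} {V : Finset (Fin d → ℝ)} (hV : Good {V})
    (hVc : V.card = d + 1) (hVT : T = cv V) (Q : Finset (Fin d → ℝ))
    (hQ : ∀ q ∈ Q, q ∈ interior T) (hQV : ∀ q ∈ Q, q ∉ V) :
    ∃ S, Tri_s17 T S ∧ (∀ v, (∃ s ∈ S, v ∈ s) ↔ v ∈ Q ∨ v ∈ V) ∧ d * Q.card + 1 ≤ S.card := by
  induction Q using Finset.induction_on with
  | empty =>
    refine ⟨{V}, ⟨by simpa using hVc, hV, by simp [hVT]⟩, by simp, by simp⟩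
  | insert p Q hp ih =>
    obtain ⟨S, hS, hv, hc⟩ := ih (fun q hq => hQ q (Finset.mem_insert_of_mem hq))
      (fun q hq => hQV q (Finset.mem_insert_of_mem hq))
    have hpS : ∀ s ∈ S, p ∉ s := by
      intro s hs hps
      rcases (hv p).1 ⟨s, hs, hps⟩ with h | h
      · exact hp h
      · exact hQV p (mem_insert_self _ _) h
    obtain ⟨S', hS', hv', hc'⟩ := subdivide hS hpS (hQ p (mem_insert_self _ _))
    refine ⟨S', hS', fun v => ?_, ?_⟩
    · rw [hv', hv, Finset.mem_insert, or_assoc]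
    · rw [card_insert_of_notMem hp, mul_add]; omega

lemma ai_image_iff {n : ℕ} {v : Fin n → Fin d → ℝ} (hv : Function.Injective v) :
    AI (Finset.univ.image v) ↔ AffineIndependent ℝ v := by
  constructor
  · intro h
    rw [affineIndependent_iff_of_fintype]
    intro w hw0 hw1 i
    rw [Finset.weightedVSub_eq_linear_combination (s := Finset.univ) (hw := hw0)] at hw1
    have := h (Function.extend v w 0)
      (by rw [Finset.sum_image (fun a _ b _ hab => hv hab)]; simpa [hv.extend_apply] using hw0)
      (by rw [Finset.sum_image (fun a _ b _ hab => hv hab)]; simpa [hv.extend_apply] using hw1)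
      (v i) (by simp)
    simpa [hv.extend_apply] using this
  · intro h c h0 h1 z hz
    rw [Finset.sum_image (fun a _ b _ hab => hv hab)] at h0 h1
    obtain ⟨i, -, rfl⟩ := Finset.mem_image.1 hz
    exact affineIndependent_iff.1 h univ (fun i => c (v i)) h0 h1 i (Finset.mem_univ i)

lemma exists_enum {n : ℕ} (hc : s.card = n) :
    ∃ v : Fin n → Fin d → ℝ, Function.Injective v ∧ Finset.univ.image v = s := by
  refine ⟨fun i => ((s.equivFinOfCardEq hc).symm i : Fin d → ℝ), ?_, ?_⟩
  · exact Subtype.val_injective.comp (Equiv.injective _)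
  · ext x
    simp only [Finset.mem_image, Finset.mem_univ, true_and]
    constructor
    · rintro ⟨i, rfl⟩; exact ((s.equivFinOfCardEq hc).symm i).2
    · intro hx; exact ⟨s.equivFinOfCardEq hc ⟨x, hx⟩, by simp⟩

lemma AI.span (h : AI s) (hc : s.card = d + 1) (x : Fin d → ℝ) :
    ∃ γ : (Fin d → ℝ) → ℝ, ∑ v ∈ s, γ v = 1 ∧ ∑ v ∈ s, γ v • v = x := by
  obtain ⟨v, hv, rfl⟩ := exists_enum hc
  have ha := (ai_image_iff hv).1 h
  have htop : affineSpan ℝ (Set.range v) = ⊤ := by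
    rw [ha.affineSpan_eq_top_iff_card_eq_finrank_add_one]; simp
  have hx : x ∈ affineSpan ℝ (Set.range v) := by rw [htop]; trivial
  obtain ⟨w, hw, hx⟩ := eq_affineCombination_of_mem_affineSpan_of_fintype hx
  rw [Finset.affineCombination_eq_linear_combination Finset.univ v w hw] at hx
  refine ⟨Function.extend v w 0, ?_, ?_⟩
  · rw [Finset.sum_image (fun a _ b _ hab => hv hab)]; simpa [hv.extend_apply] using hw
  · rw [Finset.sum_image (fun a _ b _ hab => hv hab)]; simpa [hv.extend_apply] using hx.symm

lemma apex_neg {S : Finset (Finset (Fin d → ℝ))} (hS : Good S) {f : Finset (Fin d → ℝ)}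
    {a b : Fin d → ℝ} (hf : f.Nonempty) (ha : a ∉ f) (hb : b ∉ f) (hab : a ≠ b)
    (hs : insert a f ∈ S) (ht : insert b f ∈ S) {g : ℝ} {γ : (Fin d → ℝ) → ℝ}
    (h1 : g + ∑ v ∈ f, γ v = 1) (h2 : g • a + ∑ v ∈ f, γ v • v = b) : g < 0 := by
  by_contra hg
  push Not at hg
  obtain ⟨c, κ, hκ, hκpos⟩ := wrep_center hf
  have hev : ∀ᶠ ε in nhdsWithin (0 : ℝ) (Set.Ioi 0), ∀ v ∈ f, 0 < (1 - ε) * κ v + ε * γ v := by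
    rw [Filter.eventually_all_finset]
    intro v hv
    apply Filter.Eventually.filter_mono nhdsWithin_le_nhds
    have hcont : ContinuousAt (fun ε : ℝ => (1 - ε) * κ v + ε * γ v) 0 := by fun_prop
    apply hcont.eventually_const_lt
    simpa using hκpos v hv
  have hev2 : ∀ᶠ ε in nhdsWithin (0 : ℝ) (Set.Ioi 0), ε < 1 :=
    Filter.Eventually.filter_mono nhdsWithin_le_nhds (eventually_lt_nhds (by norm_num))
  obtain ⟨ε, hε, hε1, hε0⟩ := (hev.and (hev2.and self_mem_nhdsWithin)).exists
  have hε0 : 0 < ε := hε0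
  have r2 := (hκ.mono (subset_insert b f)).combo (rep_single (mem_insert_self b f))
    (by linarith : 0 ≤ 1 - ε) hε0.le (by ring)
  have hne : ∀ v ∈ f, v ≠ a := by rintro v hv rfl; exact ha hv
  have r1 : WRep (insert a f) ((1 - ε) • c + ε • b)
      (fun v => if v = a then ε * g else if v ∈ f then (1 - ε) * κ v + ε * γ v else 0) := by
    refine ⟨fun v => ?_, fun v hv => ?_, ?_, ?_⟩
    · dsimp only; split_ifs with h3 h4
      · positivity
      · exact (hε v h4).le
      · exact le_rfl
    · simp only [Finset.mem_insert, not_or] at hv; simp [hv.1, hv.2]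
    · rw [sum_insert ha]
      rw [sum_congr rfl (fun v hv => show _ = (1 - ε) * κ v + ε * γ v by simp [hne v hv, hv])]
      rw [sum_add_distrib, ← mul_sum, ← mul_sum, hκ.2.2.1]
      simp only [if_true]
      have : ∑ v ∈ f, γ v = 1 - g := by linarith
      rw [this]; ring
    · rw [sum_insert ha]
      rw [sum_congr rfl (fun v hv => show _ = (1 - ε) • κ v • v + ε • γ v • v by
        simp [hne v hv, hv, add_smul, mul_smul])]
      rw [sum_add_distrib, ← smul_sum, ← smul_sum, hκ.2.2.2, ← h2]
      simp only [if_true]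
      module
  have h3 := congrFun (hS _ hs _ ht _ _ _ r1 r2) b
  simp only [hab.symm, hb, if_false, if_true] at h3
  have := mul_nonneg (by linarith : 0 ≤ 1 - ε) (hκ.1 b)
  linarith

lemma at_most_two {S : Finset (Finset (Fin d → ℝ))} (hS : Good S) {f : Finset (Fin d → ℝ)}
    {a b b' : Fin d → ℝ} (hf : f.Nonempty) (hc : f.card = d) (ha : a ∉ f) (hb : b ∉ f)
    (hb' : b' ∉ f) (hab : a ≠ b) (hab' : a ≠ b') (hbb' : b ≠ b')
    (hs : insert a f ∈ S) (ht : insert b f ∈ S) (ht' : insert b' f ∈ S) : False := by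
  have hai := (hS.single hs).ai
  have hcs : (insert a f).card = d + 1 := by rw [card_insert_of_notMem ha, hc]
  obtain ⟨β, e1, e2⟩ := hai.span hcs b
  obtain ⟨β', e1', e2'⟩ := hai.span hcs b'
  rw [sum_insert ha] at e1 e2 e1' e2'
  have n1 := apex_neg hS hf ha hb hab hs ht e1 e2
  have n2 := apex_neg hS hf ha hb' hab' hs ht' e1' e2'
  have hr : 0 < β' a / β a := div_pos_of_neg_of_neg n2 n1
  have hm : β' a / β a * β a = β' a := div_mul_cancel₀ _ n1.ne
  set r := β' a / β a
  have n3 := apex_neg hS hf hb hb' hbb' ht ht' (g := r) (γ := fun v => β' v - r * β v)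
    (by
      rw [sum_sub_distrib, ← mul_sum]
      have : ∑ v ∈ f, β v = 1 - β a := by linarith
      rw [this]
      have : ∑ v ∈ f, β' v = 1 - β' a := by linarith
      rw [this]; linarith)
    (by
      simp only [sub_smul, mul_smul]
      rw [sum_sub_distrib, ← smul_sum, ← e2', ← e2, smul_add, smul_smul, hm]
      abel)
  linarith

lemma corner_volume (d : ℕ) : (1 : ℝ≥0∞) / (Nat.factorial d : ℝ≥0∞) ≤
    volume {x : Fin d → ℝ | (∀ i, 0 ≤ x i) ∧ ∑ i, x i ≤ 1} := by
  set D := {x : Fin d → ℝ | (∀ i, 0 ≤ x i) ∧ ∑ i, x i ≤ 1} with hD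
  have hDc : IsClosed D := by
    have : D = (⋂ i, {x : Fin d → ℝ | 0 ≤ x i}) ∩ {x | ∑ i, x i ≤ 1} := by ext; simp [hD]
    rw [this]
    exact (isClosed_iInter (fun i => isClosed_le continuous_const (continuous_apply i))).inter
      (isClosed_le (by fun_prop) continuous_const)
  have hC := MeasureTheory.volume_sum_rpow_lt_one (Fin d) (p := 1) le_rfl
  have hsub : {x : Fin d → ℝ | ∑ i, |x i| ^ (1 : ℝ) < 1} ⊆
      ⋃ e ∈ (univ : Finset (Fin d → Bool)),
        (fun (x : Fin d → ℝ) i => (if e i then id else Neg.neg : ℝ → ℝ) (x i)) ⁻¹' D := by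
    intro x hx
    simp only [Set.mem_iUnion]
    refine ⟨fun i => decide (0 ≤ x i), Finset.mem_univ _, ?_⟩
    have key : ∀ i, (if decide (0 ≤ x i) = true then id else Neg.neg : ℝ → ℝ) (x i) = |x i| := by
      intro i
      by_cases h : 0 ≤ x i
      · simp [h, abs_of_nonneg]
      · simp [h, abs_of_neg (not_le.1 h)]
    simp only [Set.mem_preimage, hD, Set.mem_ofPred_eq, key]
    simp only [Real.rpow_one, Set.mem_ofPred_eq] at hx
    exact ⟨fun i => abs_nonneg _, hx.le⟩
  have hle := (measure_mono (μ := volume) hsub).trans (measure_biUnion_finset_le _ _)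
  have heq : ∀ e : Fin d → Bool,
      volume ((fun (x : Fin d → ℝ) i => (if e i then id else Neg.neg : ℝ → ℝ) (x i)) ⁻¹' D) = volume D := by
    intro e
    apply MeasurePreserving.measure_preimage _ hDc.measurableSet.nullMeasurableSet
    apply volume_preserving_pi
    intro i
    by_cases h : e i
    · simp only [h, if_true]; exact MeasurePreserving.id _
    · simp only [h]; exact Measure.measurePreserving_neg _
  rw [sum_congr rfl (fun e _ => heq e), hC] at hle
  simp only [sum_const, Finset.card_univ, Fintype.card_fun, Fintype.card_bool, Fintype.card_fin,
    div_one, nsmul_eq_mul] at hle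
  rw [show (1 : ℝ) + 1 = 2 by norm_num, Real.Gamma_two, mul_one, Real.Gamma_nat_eq_factorial,
    ENNReal.ofReal_div_of_pos (by positivity)] at hle
  rw [ENNReal.ofReal_pow (by norm_num), ENNReal.ofReal_natCast] at hle
  simp only [ENNReal.ofReal_ofNat] at hle
  push_cast at hle
  rw [div_eq_mul_inv] at hle
  have h2 : (2 : ℝ≥0∞) ^ d ≠ 0 := by positivity
  have h3 : (2 : ℝ≥0∞) ^ d ≠ ⊤ := by finiteness
  rw [one_div]
  exact (ENNReal.mul_le_mul_iff_right h2 h3).1 hle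

lemma simplex_volume (v : Fin (d + 1) → Fin d → ℤ)
    (hv : AffineIndependent ℝ (fun i => fun j => ((v i j : ℤ) : ℝ))) :
    (1 : ℝ≥0∞) / (Nat.factorial d : ℝ≥0∞) ≤
      volume (convexHull ℝ (Set.range (fun i => fun j => ((v i j : ℤ) : ℝ)))) := by
  set V : Fin (d + 1) → Fin d → ℝ := fun i => fun j => ((v i j : ℤ) : ℝ) with hV
  set M : Matrix (Fin d) (Fin d) ℤ := Matrix.of (fun j i => v i.succ j - v 0 j) with hM
  set A := Matrix.toLin' (M.map (Int.cast : ℤ → ℝ)) with hA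
  have hAx : ∀ x : Fin d → ℝ, A x = ∑ i, x i • (V i.succ - V 0) := by
    intro x
    ext j
    simp only [hA, Matrix.toLin'_apply, Matrix.mulVec, dotProduct, Matrix.map_apply, Matrix.of_apply, hM,
      Finset.sum_apply, Pi.smul_apply, Pi.sub_apply, smul_eq_mul, hV]
    exact sum_congr rfl (fun i _ => by push_cast; ring)
  have hdet : LinearMap.det A = (M.det : ℝ) := by
    rw [hA, LinearMap.det_toLin']
    exact (Int.cast_det M).symm
  have hdet0 : M.det ≠ 0 := by
    intro h0
    rw [h0, Int.cast_zero] at hdet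
    obtain ⟨x, hx, hx0⟩ := Submodule.exists_mem_ne_zero_of_ne_bot
      (LinearMap.bot_lt_ker_of_det_eq_zero hdet).ne'
    rw [LinearMap.mem_ker, hAx] at hx
    apply hx0
    have := affineIndependent_iff.1 hv Finset.univ (Fin.cons (- ∑ i, x i) x : Fin (d + 1) → ℝ)
      (by rw [Fin.sum_univ_succ]; simp)
      (by
        rw [Fin.sum_univ_succ, ← hx]
        simp only [Fin.cons_zero, Fin.cons_succ, smul_sub, sum_sub_distrib, neg_smul, ← sum_smul]
        abel)
    funext i
    simpa using this i.succ (Finset.mem_univ _)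
  have hdet1 : (1 : ℝ) ≤ |LinearMap.det A| := by
    rw [hdet]
    exact_mod_cast Int.one_le_abs hdet0
  set D := {x : Fin d → ℝ | (∀ i, 0 ≤ x i) ∧ ∑ i, x i ≤ 1} with hD
  have hsub : (fun y => V 0 + y) '' (A '' D) ⊆ convexHull ℝ (Set.range V) := by
    rintro _ ⟨_, ⟨x, hx, rfl⟩, rfl⟩
    have hw : ∑ i, (Fin.cons (1 - ∑ i, x i) x : Fin (d + 1) → ℝ) i • V i = V 0 + A x := by
      rw [Fin.sum_univ_succ, hAx]
      simp only [Fin.cons_zero, Fin.cons_succ, smul_sub, sum_sub_distrib, sub_smul, one_smul,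
        ← sum_smul]
      abel
    dsimp only
    rw [← hw]
    apply (convex_convexHull ℝ _).sum_mem
    · intro i _
      refine Fin.cases ?_ (fun i => ?_) i
      · simpa using hx.2
      · simpa using hx.1 i
    · rw [Fin.sum_univ_succ]; simp
    · intro i _; exact subset_convexHull ℝ _ (Set.mem_range_self i)
  refine le_trans ?_ (measure_mono hsub)
  rw [Set.image_add_left, measure_preimage_add, Measure.addHaar_image_linearMap]
  refine (corner_volume d).trans ?_
  conv_lhs => rw [← one_mul (volume _)]
  gcongr
  rw [← ENNReal.ofReal_one]
  exact ENNReal.ofReal_le_ofReal hdet1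

lemma lattice_finite {T : Set (Fin d → ℝ)} (hT : Bornology.IsBounded T) :
    (T ∩ {x | IsLatticePt d x}).Finite := by
  obtain ⟨R, hR⟩ := hT.subset_closedBall 0
  apply ((Set.finite_Icc (fun _ : Fin d => -⌈R⌉) (fun _ => ⌈R⌉)).image
    (fun z : Fin d → ℤ => fun j => (z j : ℝ))).subset
  rintro x ⟨hx, hl⟩
  choose z hz using hl
  refine ⟨z, ⟨fun i => ?_, fun i => ?_⟩, funext (fun i => (hz i).symm)⟩ <;>
  · have h1 := hR hx
    rw [mem_closedBall_zero_iff] at h1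
    have h2 := abs_le.1 ((norm_le_pi_norm x i).trans h1)
    rw [hz i] at h2
    have h3 := Int.le_ceil R
    have h4 : (-(⌈R⌉ : ℤ) : ℝ) ≤ z i := by linarith
    have h5 : (z i : ℝ) ≤ (⌈R⌉ : ℤ) := by linarith
    first | exact_mod_cast h4 | exact_mod_cast h5

lemma lattice_simplex_of {s : Finset (Fin d → ℝ)} (hs : Good {s}) (hc : s.card = d + 1)
    (hl : ∀ x ∈ s, IsLatticePt d x) :
    ∃ v : Fin (d + 1) → Fin d → ℤ,
    AffineIndependent ℝ (fun i => fun j => ((v i j : ℤ) : ℝ)) ∧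
    cv s = convexHull ℝ (Set.range (fun i => fun j => ((v i j : ℤ) : ℝ))) := by
  obtain ⟨v, hv, rfl⟩ := exists_enum hc
  have : ∀ i, ∃ z : Fin d → ℤ, v i = fun j => (z j : ℝ) := by
    intro i
    choose z hz using hl (v i) (by simp)
    exact ⟨z, funext hz⟩
  choose z hz using this
  have hvz : v = fun i => fun j => ((z i j : ℤ) : ℝ) := funext hz
  refine ⟨z, ?_, ?_⟩
  · rw [← hvz]; exact (ai_image_iff hv).1 hs.ai
  · rw [← hvz]; unfold cv; simp

lemma main_aux (d k : ℕ) (hd : 2 ≤ d)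
    (T : Set (Fin d → ℝ)) (hT : IsLatticeSimplex d T) (hclean : IsClean d T)
    (hint : {x ∈ interior T | IsLatticePt d x}.ncard = k) :
    (∃ 𝒯 : Set (Set (Fin d → ℝ)),
      IsLatticeTriangulation d T 𝒯 ∧
      triVertices d 𝒯 = T ∩ {x | IsLatticePt d x} ∧
      d * k + 1 ≤ 𝒯.ncard) ∧
    ((d * k + 1 : ℕ) : ℝ≥0∞) / (Nat.factorial d : ℝ≥0∞) ≤ volume T := by
  obtain ⟨v, hv, hTv⟩ := hT
  set V : Finset (Fin d → ℝ) := Finset.univ.image (fun i => fun j => ((v i j : ℤ) : ℝ)) with hV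
  have hVai : AI V := (ai_image_iff hv.injective).2 hv
  have hVg : Good {V} := hVai.good
  have hVc : V.card = d + 1 := by rw [hV, card_image_of_injective _ hv.injective]; simp
  have hTV : T = cv V := by rw [hTv]; unfold cv; simp [hV]
  have hVext : Set.extremePoints ℝ T = V := by rw [hTV]; exact ext_cv hVg
  have hTcl : IsClosed T := hTV ▸ isClosed_cv V
  have hTb : Bornology.IsBounded T := by
    rw [hTV]; exact (V.finite_toSet.isCompact_convexHull ℝ).isBounded
  have hLfin := lattice_finite hTb
  have hQfin : {x ∈ interior T | IsLatticePt d x}.Finite :=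
    hLfin.subset (fun x hx => ⟨interior_subset hx.1, hx.2⟩)
  have hclean' : ∀ x, x ∈ V ↔ x ∈ frontier T ∧ IsLatticePt d x := by
    intro x
    rw [← Finset.mem_coe, ← hVext, ← hclean]; rfl
  set Q := hQfin.toFinset with hQ
  have hQmem : ∀ x, x ∈ Q ↔ x ∈ interior T ∧ IsLatticePt d x := by intro x; simp [hQ]
  have hQc : Q.card = k := by rw [← hint, Set.ncard_eq_toFinset_card _ hQfin]
  obtain ⟨S, hS, hSv, hSc⟩ := tri_iter hVg hVc hTV Q (fun q hq => ((hQmem q).1 hq).1)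
    (fun q hq hqV => by
      have h1 := ((hclean' q).1 hqV).1
      exact h1.2 ((hQmem q).1 hq).1)
  rw [hQc] at hSc
  have hvert : ∀ x, (∃ s ∈ S, x ∈ s) ↔ x ∈ T ∧ IsLatticePt d x := by
    intro x
    rw [hSv, hQmem, hclean']
    constructor
    · rintro (h | h)
      · exact ⟨interior_subset h.1, h.2⟩
      · exact ⟨hTcl.frontier_subset h.1, h.2⟩
    · rintro ⟨h1, h2⟩
      by_cases h : x ∈ interior T
      · exact Or.inl ⟨h, h2⟩
      · exact Or.inr ⟨⟨subset_closure h1, h⟩, h2⟩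
  have hext : ∀ s ∈ S, Set.extremePoints ℝ (cv s) = s := fun s hs => ext_cv (hS.good.single hs)
  have hinj : Set.InjOn cv (S : Set (Finset (Fin d → ℝ))) := by
    intro s hs t ht hst
    have h1 := hext s (by exact_mod_cast hs)
    have h2 := hext t (by exact_mod_cast ht)
    rw [hst, h2] at h1
    exact_mod_cast h1.symm
  have hsT : ∀ s ∈ S, cv s ⊆ T := fun s hs x hx => (hS.cover x).2 ⟨s, hs, hx⟩
  have htv : ∀ x, x ∈ triVertices d (cv '' (S : Set (Finset (Fin d → ℝ)))) ↔ ∃ s ∈ S, x ∈ s := by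
    intro x
    unfold triVertices
    simp only [Set.mem_iUnion, Set.mem_image, Finset.mem_coe]
    constructor
    · rintro ⟨_, ⟨s, hs, rfl⟩, hx⟩
      rw [hext s hs] at hx
      exact ⟨s, hs, by exact_mod_cast hx⟩
    · rintro ⟨s, hs, hx⟩
      refine ⟨_, ⟨s, hs, rfl⟩, ?_⟩
      rw [hext s hs]; exact_mod_cast hx
  have hlat : ∀ s ∈ S, _ := fun s hs => lattice_simplex_of (hS.good.single hs) (hS.card s hs)
    (fun x hx => ((hvert x).1 ⟨s, hs, hx⟩).2)
  have hdisj : ∀ s ∈ S, ∀ t ∈ S, s ≠ t → interior (cv s) ∩ interior (cv t) = ∅ :=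
    fun s hs t ht hst => interior_disj hS.good hs ht ((hS.card s hs).trans (hS.card t ht).symm) hst
  refine ⟨⟨cv '' (S : Set (Finset (Fin d → ℝ))), ⟨?_, ?_, ?_, ?_, ?_, ?_, ?_, ?_⟩, ?_, ?_⟩, ?_⟩
  · exact S.finite_toSet.image _
  · rintro _ ⟨s, hs, rfl⟩
    exact ⟨hlat s hs, hsT s hs⟩
  · rintro _ ⟨s, hs, rfl⟩ x hx
    rw [hext s hs] at hx
    exact (hvert x).1 ⟨s, hs, by exact_mod_cast hx⟩
  · intro x hx
    rw [htv, hSv]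
    rw [hVext] at hx
    exact Or.inr (by exact_mod_cast hx)
  · rintro _ ⟨s, hs, rfl⟩ _ ⟨t, ht, rfl⟩ hst
    exact hdisj s hs t ht (fun h => hst (by rw [h]))
  · -- facets
    have hfac : ∀ s ∈ S, ∀ F, IsFacetOf d F (cv s) ↔ ∃ u ∈ s, F = cv (s.erase u) := by
      intro s hs F
      unfold IsFacetOf
      rw [hext s hs]
      simp only [cv, Finset.coe_erase, Finset.mem_coe]
    rintro _ ⟨s, hs, rfl⟩ F hF
    have hs : s ∈ S := by exact_mod_cast hs
    obtain ⟨u, hu, rfl⟩ := (hfac s hs F).1 hF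
    by_cases hfr : cv (s.erase u) ⊆ frontier T
    · exact Or.inl hfr
    right
    obtain ⟨q, hq, hqf⟩ := Set.not_subset.1 hfr
    have hqT : q ∈ T := hsT s hs (cv_mono (erase_subset u s) hq)
    have hqi : q ∈ interior T := by
      by_contra h; exact hqf ⟨subset_closure hqT, h⟩
    obtain ⟨t, ht, hts, hsub⟩ := facet_exists hS hs hu hq hqi
    have hfc : (s.erase u).card = d := by rw [card_erase_of_mem hu, hS.card s hs]; rfl
    have hfne : (s.erase u).Nonempty := card_pos.1 (by omega)
    obtain ⟨b, hb, hbt⟩ : ∃ b, b ∉ s.erase u ∧ insert b (s.erase u) = t := by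
      have := (Finset.covBy_iff_exists_insert (s := s.erase u) (t := t)).1
        (Finset.covBy_iff_card_sdiff_eq_one.2 ⟨hsub, by
          rw [card_sdiff_of_subset hsub, hS.card t ht, hfc]; omega⟩)
      obtain ⟨b, hb, h⟩ := this
      exact ⟨b, hb, h⟩
    have hus : insert u (s.erase u) = s := insert_erase hu
    refine ⟨cv t, ⟨t, ht, rfl⟩, fun h => hts (hinj ht hs h), ?_, ?_⟩
    · refine (hfac t ht _).2 ⟨b, by rw [← hbt]; exact mem_insert_self _ _, ?_⟩
      rw [← hbt, erase_insert hb]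
    · rintro _ ⟨t', ht', rfl⟩ hF'
      have ht' : t' ∈ S := by exact_mod_cast ht'
      obtain ⟨b', hb', he⟩ := (hfac t' ht' _).1 hF'
      have he' : s.erase u = t'.erase b' := by
        have e1 := ext_cv ((hS.good.single hs).sub (erase_subset u s))
        have e2 := ext_cv ((hS.good.single ht').sub (erase_subset b' t'))
        rw [he, e2] at e1
        exact_mod_cast e1.symm
      have hb't : insert b' (s.erase u) = t' := by rw [he', insert_erase hb']
      have hb'n : b' ∉ s.erase u := by rw [he']; simp
      by_contra hcon
      push Not at hcon
      refine at_most_two hS.good hfne hfc (a := u) (b := b) (b' := b') (by simp) hb hb'n ?_ ?_ ?_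
        (by rw [hus]; exact hs) (by rw [hbt]; exact ht) (by rw [hb't]; exact ht')
      · rintro rfl; exact hts (hbt.symm.trans hus)
      · rintro rfl; exact hcon.1 (by rw [← hb't, hus])
      · rintro rfl; exact hcon.2 (by rw [← hb't, hbt])
  · rintro _ ⟨s, hs, rfl⟩ x hx hxs
    have hs : s ∈ S := by exact_mod_cast hs
    rw [hext s hs]
    obtain ⟨t, ht, hxt⟩ := (htv x).1 hx
    obtain ⟨w, hw⟩ := mem_cv_iff.1 hxs
    have h1 := congrFun (hS.good s hs t ht _ _ _ hw (rep_single hxt)) x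
    simp only [if_true] at h1
    by_contra hcon
    rw [hw.2.1 x (by exact_mod_cast hcon)] at h1
    norm_num at h1
  · ext x
    rw [hS.cover]
    simp
  · ext x
    rw [htv, hvert]; rfl
  · rw [hinj.ncard_image, Set.ncard_coe_finset]; exact hSc
  · have hvol : ∀ s ∈ S, (1 : ℝ≥0∞) / (Nat.factorial d : ℝ≥0∞) ≤ volume (interior (cv s)) := by
      intro s hs
      obtain ⟨z, hz, he⟩ := hlat s hs
      have h1 := simplex_volume z hz
      rw [← he] at h1
      refine h1.trans ?_
      have hconv : Convex ℝ (cv s) := convex_convexHull ℝ _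
      have h0 := hconv.addHaar_frontier volume
      calc volume (cv s) ≤ volume (interior (cv s) ∪ frontier (cv s)) := by
            apply measure_mono
            intro x hx
            by_cases h : x ∈ interior (cv s)
            · exact Or.inl h
            · exact Or.inr ⟨subset_closure hx, h⟩
        _ ≤ _ := measure_union_le _ _
        _ = _ := by rw [h0, add_zero]
    calc ((d * k + 1 : ℕ) : ℝ≥0∞) / (Nat.factorial d : ℝ≥0∞)
        ≤ (S.card : ℝ≥0∞) * (1 / (Nat.factorial d : ℝ≥0∞)) := by
          rw [mul_one_div]; gcongr
      _ = ∑ s ∈ S, 1 / (Nat.factorial d : ℝ≥0∞) := by rw [sum_const, nsmul_eq_mul]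
      _ ≤ ∑ s ∈ S, volume (interior (cv s)) := sum_le_sum hvol
      _ = volume (⋃ s ∈ S, interior (cv s)) := by
          rw [measure_biUnion_finset]
          · intro s hs t ht hst
            exact Set.disjoint_iff_inter_eq_empty.2 (hdisj s hs t ht hst)
          · intro s _; exact isOpen_interior.measurableSet
      _ ≤ volume T := by
          apply measure_mono
          exact Set.iUnion₂_subset (fun s hs => interior_subset.trans (hsT s hs))

end Aux

/-- A clean lattice `d`-simplex (`d ≥ 2`) with exactly `k` interior
lattice points admits a full lattice triangulation with at least `dk + 1` simplices;
consequently `Vol(T) ≥ (dk + 1)/d!`. -/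
theorem full_triangulation_and_volume (d k : ℕ) (hd : 2 ≤ d)
    (T : Set (Fin d → ℝ)) (hT : IsLatticeSimplex d T) (hclean : IsClean d T)
    (hint : {x ∈ interior T | IsLatticePt d x}.ncard = k) :
    (∃ 𝒯 : Set (Set (Fin d → ℝ)),
      IsLatticeTriangulation d T 𝒯 ∧
      triVertices d 𝒯 = T ∩ {x | IsLatticePt d x} ∧
      d * k + 1 ≤ 𝒯.ncard) ∧
    ((d * k + 1 : ℕ) : ℝ≥0∞) / (Nat.factorial d : ℝ≥0∞) ≤ volume T := by
  exact main_aux d k hd T hT hclean hint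
end
end
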